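/- There exists C > 0 depending only on n and W such that for every sufficiently large R there exist functions g_Q : ℝ → [-1,1] (for each Q ≤ (4R)^{5/2} large) satisfying the conclusions of the 1D barrier construction (g_Q is C² and strictly increasing on an interval [t_Q^-, t_Q^+] with |t_Q^±| ≤ C log Q, constant outside it with value 1 on the right, g_Q(0)=0, g_Q'(t_Q^-)=0, |g-g_Q| ≤ C/Q on [-4,4], and g_Q'' + (2(n-1)/Q)g_Q' ≤ W'(g_Q) + (C/Q)χ_{[-1,1]} in the viscosity sense) and a function ρ_R : ℝ → [-1,1] with real numbers q_R^- < 0 < q_R^+, |q_R^±| ≤ R/2, such that: (1) ρ_R is C² and strictly increasing on [q_R^-, q_R^+], constant on (-∞, q_R^-], and ρ_R = 1 on [q_R^+, ∞); (2) ρ_R(0)=0, ρ_R'(q_R^-)=0, and |g - ρ_R| ≤ C/R on [-4,4]; (3) ρ_R'' + (2(n-1)/R) ρ_R' ≤ W'(ρ_R) + (C/R)·χ_{[-1,1]} in the viscosity sense; (4) ρ_R(s) ≤ g_Q(s + R^{-1/5}) for all s ∈ ℝ and all Q ≤ (4R)^{5/2}. -/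

import Mathlib

open MeasureTheory Metric Set Filter

noncomputable section

/-- `W` is a double-well potential. -/
def DoubleWell (W : ℝ → ℝ) : Prop :=
  ContDiffOn ℝ 2 W (Set.Icc (-1) 1) ∧ W (-1) = 0 ∧ W 1 = 0 ∧
  (∀ s ∈ Set.Ioo (-1:ℝ) 1, 0 < W s) ∧ deriv W (-1) = 0 ∧ deriv W 1 = 0 ∧
  0 < deriv (deriv W) (-1) ∧ 0 < deriv (deriv W) 1

/-- `g` is the one-dimensional solution of `g'' = W'(g)`, `g' > 0`, `g(0)=0`,
`g(±∞) = ±1`. -/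
def IsOneDSolution (W g : ℝ → ℝ) : Prop :=
  ContDiff ℝ 2 g ∧ (∀ t, g t ∈ Set.Ioo (-1:ℝ) 1) ∧
  (∀ t, deriv (deriv g) t = deriv W (g t)) ∧ (∀ t, 0 < deriv g t) ∧ g 0 = 0 ∧
  Tendsto g atTop (nhds 1) ∧ Tendsto g atBot (nhds (-1))

/-- The differential inequality `f'' + (2(n-1)/Q) f' ≤ W'(f) + (C/Q)χ_{[-1,1]}` in the
viscosity sense: pointwise where `f` is twice differentiable, via `C²` test functions
touching `f` from below elsewhere. -/
def OneDViscIneq (n : ℕ) (W : ℝ → ℝ) (C Q : ℝ) (f : ℝ → ℝ) : Prop :=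
  ∀ t : ℝ,
    (ContDiffAt ℝ 2 f t →
      deriv (deriv f) t + (2 * ((n:ℝ) - 1) / Q) * deriv f t ≤
        deriv W (f t) + (C / Q) * Set.indicator (Set.Icc (-1:ℝ) 1) (fun _ => (1:ℝ)) t) ∧
    (¬ ContDiffAt ℝ 2 f t →
      ∀ ψ : ℝ → ℝ, ContDiff ℝ 2 ψ → ψ t = f t → (∀ s, ψ s ≤ f s) →
        deriv (deriv ψ) t + (2 * ((n:ℝ) - 1) / Q) * deriv ψ t ≤
          deriv W (f t) + (C / Q) * Set.indicator (Set.Icc (-1:ℝ) 1) (fun _ => (1:ℝ)) t)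

/-- `gQ` is a one-dimensional barrier of parameter `Q` as in Lemma 5.1: `C²` and strictly
increasing on `[t⁻, t⁺]` with `|t^±| ≤ C log Q`, constant outside with value `1` on the right,
`gQ(0)=0`, `gQ'(t⁻)=0`, `|g - gQ| ≤ C/Q` on `[-4,4]`, and the viscosity inequality
`gQ'' + (2(n-1)/Q) gQ' ≤ W'(gQ) + (C/Q)χ_{[-1,1]}`. -/
def OneDBarrier (n : ℕ) (W g : ℝ → ℝ) (C Q : ℝ) (gQ : ℝ → ℝ) : Prop :=
  ∃ tm tp : ℝ, tm < 0 ∧ 0 < tp ∧ |tm| ≤ C * Real.log Q ∧ |tp| ≤ C * Real.log Q ∧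
    (∀ t, gQ t ∈ Set.Icc (-1:ℝ) 1) ∧
    ContDiffOn ℝ 2 gQ (Set.Icc tm tp) ∧
    StrictMonoOn gQ (Set.Icc tm tp) ∧
    (∀ t ≤ tm, gQ t = gQ tm) ∧
    (∀ t, tp ≤ t → gQ t = 1) ∧
    gQ 0 = 0 ∧ deriv gQ tm = 0 ∧
    (∀ t ∈ Set.Icc (-4:ℝ) 4, |g t - gQ t| ≤ C / Q) ∧
    OneDViscIneq n W C Q gQ

/-- A function with continuous one-sided data is differentiable up to the endpoints. -/
theorem hasDerivWithinAt_Icc_of_Ioo {f f' : ℝ → ℝ} {a b : ℝ} (hab : a < b)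
    (hf : ContinuousOn f (Icc a b)) (hd : ∀ x ∈ Ioo a b, HasDerivAt f (f' x) x)
    (hf' : ContinuousOn f' (Icc a b)) {x : ℝ} (hx : x ∈ Icc a b) :
    HasDerivWithinAt f (f' x) (Icc a b) x := by
  have hdiff : DifferentiableOn ℝ f (Ioo a b) := fun y hy =>
    (hd y hy).differentiableAt.differentiableWithinAt
  rcases eq_or_lt_of_le hx.1 with rfl | h1
  · have hnhds : Ioo a b ∈ nhdsWithin a (Ioi a) := Ioo_mem_nhdsGT hab
    refine (hasDerivWithinAt_Ici_of_tendsto_deriv hdiff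
      ((hf a hx).mono Ioo_subset_Icc_self) hnhds ?_).mono Icc_subset_Ici_self
    have h : Tendsto f' (nhdsWithin a (Ioi a)) (nhds (f' a)) :=
      ((hf' a hx).mono Ioo_subset_Icc_self).mono_left (nhdsWithin_le_of_mem hnhds)
    refine h.congr' ?_
    filter_upwards [hnhds] with y hy using (hd y hy).deriv.symm
  rcases eq_or_lt_of_le hx.2 with rfl | h2
  · have hnhds : Ioo a x ∈ nhdsWithin x (Iio x) := Ioo_mem_nhdsLT hab
    refine (hasDerivWithinAt_Iic_of_tendsto_deriv hdiff
      ((hf x hx).mono Ioo_subset_Icc_self) hnhds ?_).mono Icc_subset_Iic_self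
    have h : Tendsto f' (nhdsWithin x (Iio x)) (nhds (f' x)) :=
      ((hf' x hx).mono Ioo_subset_Icc_self).mono_left (nhdsWithin_le_of_mem hnhds)
    refine h.congr' ?_
    filter_upwards [hnhds] with y hy using (hd y hy).deriv.symm
  · exact (hd x ⟨h1, h2⟩).hasDerivWithinAt

theorem contDiffOn_two_Icc {f f' f'' : ℝ → ℝ} {a b : ℝ} (hab : a < b)
    (hf : ∀ x ∈ Icc a b, HasDerivWithinAt f (f' x) (Icc a b) x)
    (hf' : ∀ x ∈ Icc a b, HasDerivWithinAt f' (f'' x) (Icc a b) x)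
    (hf'' : ContinuousOn f'' (Icc a b)) : ContDiffOn ℝ 2 f (Icc a b) := by
  have hu := uniqueDiffOn_Icc hab
  have h1 : ContDiffOn ℝ 1 f' (Icc a b) := by
    rw [show (1 : WithTop ℕ∞) = 0 + 1 from rfl, contDiffOn_succ_iff_derivWithin hu]
    refine ⟨fun x hx => (hf' x hx).differentiableWithinAt, by simp, ?_⟩
    rw [contDiffOn_zero]
    exact hf''.congr fun x hx => (hf' x hx).derivWithin (hu x hx)
  rw [show (2 : WithTop ℕ∞) = 1 + 1 from rfl, contDiffOn_succ_iff_derivWithin hu]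
  refine ⟨fun x hx => (hf x hx).differentiableWithinAt, by simp, ?_⟩
  exact h1.congr fun x hx => (hf x hx).derivWithin (hu x hx)

/-- A function lying below its critical value to the left of a critical point has nonpositive
second derivative there. -/
theorem deriv_deriv_nonpos_of_le_left {ψ : ℝ → ℝ} {t : ℝ} (hψ : ContDiffAt ℝ 2 ψ t)
    (hd : deriv ψ t = 0) (hle : ∀ s ≤ t, ψ s ≤ ψ t) : deriv (deriv ψ) t ≤ 0 := by
  by_contra! hpos
  have hev : ∀ᶠ s in nhdsWithin t (Iio t), deriv ψ s < 0 := by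
    have hdd : HasDerivAt (deriv ψ) (deriv (deriv ψ) t) t :=
      (differentiableAt_of_deriv_ne_zero hpos.ne').hasDerivAt
    have h := hdd.tendsto_slope.eventually (lt_mem_nhds hpos)
    have h' : ∀ᶠ s in nhdsWithin t (Iio t), 0 < slope (deriv ψ) t s :=
      h.filter_mono (nhdsWithin_mono _ fun s hs => ne_of_lt hs)
    filter_upwards [h', self_mem_nhdsWithin] with s hs hst
    rw [slope_def_field, hd, sub_zero] at hs
    have hst' : s - t < 0 := sub_neg.2 hst
    by_contra! hcon
    exact absurd hs (not_lt.2 (div_nonpos_of_nonneg_of_nonpos hcon hst'.le))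
  have hdiff : ∀ᶠ s in nhds t, DifferentiableAt ℝ ψ s := by
    filter_upwards [hψ.eventually (by simp)] with s hs using hs.differentiableAt (by simp)
  obtain ⟨l, hl, hlt⟩ := (mem_nhdsLT_iff_exists_Ioo_subset).1
    (hev.and (hdiff.filter_mono nhdsWithin_le_nhds))
  have hlt' : l < t := hl
  set m := (l + t) / 2 with hm
  have hml : l < m := by rw [hm]; linarith
  have hmt : m < t := by rw [hm]; linarith
  have hanti : StrictAntiOn ψ (Icc m t) := by
    apply strictAntiOn_of_deriv_neg (convex_Icc _ _)
    · intro s hs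
      rcases eq_or_lt_of_le hs.2 with rfl | h
      · exact hψ.continuousAt.continuousWithinAt
      · exact (hlt ⟨hml.trans_le hs.1, h⟩).2.continuousAt.continuousWithinAt
    · intro s hs
      rw [interior_Icc] at hs
      exact (hlt ⟨hml.trans hs.1, hs.2⟩).1
  have := hanti (left_mem_Icc.2 hmt.le) (right_mem_Icc.2 hmt.le) hmt
  exact absurd (hle m hmt.le) (not_le.2 this)

theorem hasDerivAt_logPrimitive {a y : ℝ} (ha : 0 < a) (hy : 0 < y) :
    HasDerivAt (fun y => 2 * Real.log (√y + √(y + a))) (√(y * (y + a)))⁻¹ y := by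
  have h1 : HasDerivAt (fun y : ℝ => √y) (1 / (2 * √y)) y := Real.hasDerivAt_sqrt hy.ne'
  have hya : 0 < y + a := by positivity
  have h2 : HasDerivAt (fun y : ℝ => √(y + a)) (1 / (2 * √(y + a))) y := by
    simpa using ((hasDerivAt_id y).add_const a).sqrt hya.ne'
  have hs1 : 0 < √y := Real.sqrt_pos.2 hy
  have hs2 : 0 < √(y + a) := Real.sqrt_pos.2 hya
  have h3 := ((h1.add h2).log (by simp only [Pi.add_apply]; positivity)).const_mul 2
  refine h3.congr_deriv ?_
  rw [Real.sqrt_mul hy.le]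
  simp only [Pi.add_apply]
  field_simp
  ring

/-- If `F ≥ k² y (y + a)` at distance `y` from `p`, the travel time from `p` is logarithmic
in `a`. -/
theorem travel_left {F : ℝ → ℝ} {p q k a : ℝ} (hpq : p ≤ q) (hq1 : q - p ≤ 1) (hk : 0 < k)
    (ha : 0 < a) (ha1 : a ≤ 1) (hF : ContinuousOn F (Icc p q))
    (hlow : ∀ u ∈ Icc p q, k ^ 2 * ((u - p) * (u - p + a)) ≤ F u) :
    IntervalIntegrable (fun u => (√(2 * F u))⁻¹) volume p q ∧
      ∫ u in p..q, (√(2 * F u))⁻¹ ≤ k⁻¹ * Real.log (9 / a) := by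
  set P : ℝ → ℝ := fun u => k⁻¹ * (2 * Real.log (√(u - p) + √(u - p + a))) with hP
  have hPc : ContinuousOn P (Icc p q) := by
    refine ContinuousOn.mul continuousOn_const (ContinuousOn.mul continuousOn_const ?_)
    refine ContinuousOn.log (by fun_prop) ?_
    intro u hu
    have : 0 < √(u - p + a) := Real.sqrt_pos.2 (by linarith [hu.1])
    positivity
  have hPd : ∀ u ∈ Ioo p q, HasDerivAt P (k⁻¹ * (√((u - p) * (u - p + a)))⁻¹) u := by
    intro u hu
    have h := hasDerivAt_logPrimitive ha (sub_pos.2 hu.1)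
    have h2 : HasDerivAt (fun u : ℝ => u - p) 1 u := (hasDerivAt_id u).sub_const p
    have := (HasDerivAt.comp u h h2).const_mul k⁻¹
    simpa [P, Function.comp_def] using this
  have hnn : ∀ u ∈ Ioo p q, 0 ≤ k⁻¹ * (√((u - p) * (u - p + a)))⁻¹ := fun u _ => by positivity
  have hint := intervalIntegral.integrableOn_deriv_of_nonneg hPc hPd hnn
  have hintI : IntervalIntegrable (fun u => k⁻¹ * (√((u - p) * (u - p + a)))⁻¹) volume p q :=
    (intervalIntegrable_iff_integrableOn_Ioc_of_le hpq).2 hint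
  have hval := intervalIntegral.integral_eq_sub_of_hasDerivAt_of_le hpq hPc hPd hintI
  have hle : ∀ u ∈ Ioc p q, (√(2 * F u))⁻¹ ≤ k⁻¹ * (√((u - p) * (u - p + a)))⁻¹ := by
    intro u hu
    have hu0 : 0 < u - p := sub_pos.2 hu.1
    have hX : 0 < (u - p) * (u - p + a) := by positivity
    rw [← mul_inv]
    apply inv_anti₀ (by positivity)
    apply Real.le_sqrt_of_sq_le
    rw [mul_pow, Real.sq_sqrt hX.le]
    have := hlow u (Ioc_subset_Icc_self hu)
    nlinarith [mul_pos (pow_pos hk 2) hX]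
  have hmeas : AEStronglyMeasurable (fun u => (√(2 * F u))⁻¹) (volume.restrict (Ioc p q)) := by
    have h : ContinuousOn (fun u => √(2 * F u)) (Ioc p q) :=
      (Real.continuous_sqrt.comp_continuousOn (continuousOn_const.mul hF)).mono
        Ioc_subset_Icc_self
    exact (h.aemeasurable measurableSet_Ioc).inv.aestronglyMeasurable
  have hwint : IntervalIntegrable (fun u => (√(2 * F u))⁻¹) volume p q := by
    rw [intervalIntegrable_iff_integrableOn_Ioc_of_le hpq]
    refine Integrable.mono' hint hmeas ?_
    refine (ae_restrict_iff' measurableSet_Ioc).2 (Eventually.of_forall fun u hu => ?_)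
    rw [Real.norm_of_nonneg (by positivity)]
    exact hle u hu
  refine ⟨hwint, ?_⟩
  calc ∫ u in p..q, (√(2 * F u))⁻¹
      ≤ ∫ u in p..q, k⁻¹ * (√((u - p) * (u - p + a)))⁻¹ := by
        apply intervalIntegral.integral_mono_on_of_le_Ioo hpq hwint hintI
        exact fun u hu => hle u (Ioo_subset_Ioc_self hu)
    _ = P q - P p := hval
    _ ≤ k⁻¹ * Real.log (9 / a) := by
        have hsa : 0 < √a := Real.sqrt_pos.2 ha
        have e1 : P p = k⁻¹ * (2 * Real.log √a) := by simp [P]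
        have h1 : √(q - p) ≤ 1 := Real.sqrt_le_one.2 hq1
        have h2 : √(q - p + a) ≤ 2 := by
          rw [show (2 : ℝ) = √(2 ^ 2) by simp]
          exact Real.sqrt_le_sqrt (by linarith)
        have h3 : 0 < √(q - p + a) := Real.sqrt_pos.2 (by linarith)
        have h4 : Real.log (√(q - p) + √(q - p + a)) ≤ Real.log 3 :=
          Real.log_le_log (by positivity) (by linarith)
        rw [e1, Real.log_sqrt ha.le, Real.log_div (by norm_num) ha.ne',
          show (9 : ℝ) = 3 ^ 2 by norm_num, Real.log_pow]
        have hk' : 0 < k⁻¹ := inv_pos.2 hk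
        simp only [P]
        rw [← mul_sub]
        apply mul_le_mul_of_nonneg_left _ hk'.le
        push_cast
        linarith

theorem travel_right {F : ℝ → ℝ} {p q k a : ℝ} (hpq : p ≤ q) (hq1 : q - p ≤ 1) (hk : 0 < k)
    (ha : 0 < a) (ha1 : a ≤ 1) (hF : ContinuousOn F (Icc p q))
    (hlow : ∀ u ∈ Icc p q, k ^ 2 * ((q - u) * (q - u + a)) ≤ F u) :
    IntervalIntegrable (fun u => (√(2 * F u))⁻¹) volume p q ∧
      ∫ u in p..q, (√(2 * F u))⁻¹ ≤ k⁻¹ * Real.log (9 / a) := by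
  have hmaps : MapsTo (fun u : ℝ => -u) (Icc (-q) (-p)) (Icc p q) := fun u hu =>
    ⟨by linarith [hu.2], by linarith [hu.1]⟩
  have h := travel_left (F := fun u => F (-u)) (p := -q) (q := -p) (neg_le_neg hpq)
    (by linarith) hk ha ha1 (hF.comp continuousOn_neg hmaps) (fun u hu => by
      have := hlow (-u) (hmaps hu)
      convert this using 3 <;> ring)
  refine ⟨?_, ?_⟩
  · have := (IntervalIntegrable.iff_comp_neg (f := fun u => (√(2 * F u))⁻¹)
      (a := p) (b := q)).2 h.1.symm
    exact this
  · have := intervalIntegral.integral_comp_neg (a := -q) (b := -p)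
      (fun u => (√(2 * F u))⁻¹)
    simp only [neg_neg] at this
    rw [← this]
    exact h.2

/-- The time that the solution of `y' = √(2 F(y))`, `y(0) = 0` needs to reach the value `u`. -/
def travelTime (F : ℝ → ℝ) (u : ℝ) : ℝ := ∫ v in (0:ℝ)..u, (√(2 * F v))⁻¹

/-- `F` is an energy profile: positive on `(c, 1]`, vanishing at `c`, with finite travel times. -/
structure IsEnergy (F : ℝ → ℝ) (c : ℝ) : Prop where
  neg : c < 0
  cont : ContinuousOn F (Icc c 1)
  pos : ∀ u ∈ Ioc c 1, 0 < F u
  zero : F c = 0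
  int : IntervalIntegrable (fun v => (√(2 * F v))⁻¹) volume c 1

/-- `G` is the inverse of the travel time of `F` on `[c, 1]`, extended by constants. -/
structure IsProfile (F : ℝ → ℝ) (c : ℝ) (G : ℝ → ℝ) : Prop where
  mono : Monotone G
  mem : ∀ t, G t ∈ Icc c 1
  left : ∀ t ≤ travelTime F c, G t = c
  right : ∀ t, travelTime F 1 ≤ t → G t = 1
  leftInv : ∀ u ∈ Icc c 1, G (travelTime F u) = u
  rightInv : ∀ t ∈ Icc (travelTime F c) (travelTime F 1), travelTime F (G t) = t
  cont : Continuous G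

namespace IsEnergy

variable {F : ℝ → ℝ} {c : ℝ}

theorem lt_one (h : IsEnergy F c) : c < 1 := h.neg.trans one_pos

theorem int_sub (h : IsEnergy F c) {p q : ℝ} (hp : p ∈ Icc c 1) (hq : q ∈ Icc c 1) :
    IntervalIntegrable (fun v => (√(2 * F v))⁻¹) volume p q := by
  apply h.int.mono_set
  rw [uIcc_of_le h.lt_one.le]
  exact uIcc_subset_Icc hp hq

theorem zero_mem (h : IsEnergy F c) : (0:ℝ) ∈ Icc c 1 := ⟨h.neg.le, zero_le_one⟩

theorem travelTime_sub (h : IsEnergy F c) {p q : ℝ} (hp : p ∈ Icc c 1) (hq : q ∈ Icc c 1) :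
    travelTime F q - travelTime F p = ∫ v in p..q, (√(2 * F v))⁻¹ :=
  intervalIntegral.integral_interval_sub_left (h.int_sub h.zero_mem hq) (h.int_sub h.zero_mem hp)

theorem strictMonoOn (h : IsEnergy F c) : StrictMonoOn (travelTime F) (Icc c 1) := by
  intro p hp q hq hpq
  rw [← sub_pos, h.travelTime_sub hp hq]
  apply intervalIntegral.intervalIntegral_pos_of_pos_on (h.int_sub hp hq) _ hpq
  intro v hv
  have := h.pos v ⟨hp.1.trans_lt hv.1, hv.2.le.trans hq.2⟩
  positivity

theorem continuousOn (h : IsEnergy F c) : ContinuousOn (travelTime F) (Icc c 1) := by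
  have := intervalIntegral.continuousOn_primitive_interval' (a := 0) h.int
    (by rw [uIcc_of_le h.lt_one.le]; exact h.zero_mem)
  rwa [uIcc_of_le h.lt_one.le] at this

theorem travelTime_zero : travelTime F 0 = 0 := by simp [travelTime]

theorem travelTime_neg (h : IsEnergy F c) : travelTime F c < 0 := by
  rw [← travelTime_zero (F := F)]
  exact h.strictMonoOn (left_mem_Icc.2 h.lt_one.le) h.zero_mem h.neg

theorem travelTime_pos (h : IsEnergy F c) : 0 < travelTime F 1 := by
  conv_lhs => rw [← travelTime_zero (F := F)]
  exact h.strictMonoOn h.zero_mem (right_mem_Icc.2 h.lt_one.le) one_pos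

theorem hasDerivAt (h : IsEnergy F c) {u : ℝ} (hu : u ∈ Ioo c 1) :
    HasDerivAt (travelTime F) (√(2 * F u))⁻¹ u := by
  have hc : ContinuousOn (fun v => (√(2 * F v))⁻¹) (Ioo c 1) := by
    apply ContinuousOn.inv₀
    · exact (Real.continuous_sqrt.comp_continuousOn (continuousOn_const.mul h.cont)).mono
        Ioo_subset_Icc_self
    · intro v hv
      have := h.pos v (Ioo_subset_Ioc_self hv)
      positivity
  exact intervalIntegral.integral_hasDerivAt_right
    (h.int_sub h.zero_mem (Ioo_subset_Icc_self hu))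
    (hc.stronglyMeasurableAtFilter isOpen_Ioo u hu) (hc.continuousAt (isOpen_Ioo.mem_nhds hu))

theorem exists_profile (h : IsEnergy F c) : ∃ G, IsProfile F c G := by
  have hcI := left_mem_Icc.2 h.lt_one.le
  have h1I := right_mem_Icc.2 h.lt_one.le
  have hlt : travelTime F c ≤ travelTime F 1 := (h.travelTime_neg.trans h.travelTime_pos).le
  have hsurj : SurjOn (travelTime F) (Icc c 1) (Icc (travelTime F c) (travelTime F 1)) :=
    intermediate_value_Icc h.lt_one.le h.continuousOn
  set G : ℝ → ℝ := fun t =>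
    Function.invFunOn (travelTime F) (Icc c 1) (projIcc _ _ hlt t) with hG
  have hmem : ∀ t, G t ∈ Icc c 1 := fun t => Function.invFunOn_mem (hsurj (projIcc _ _ hlt t).2)
  have hT : ∀ t, travelTime F (G t) = projIcc _ _ hlt t := fun t =>
    Function.invFunOn_eq (hsurj (projIcc _ _ hlt t).2)
  have hinv : ∀ u ∈ Icc c 1, G (travelTime F u) = u := by
    intro u hu
    apply h.strictMonoOn.injOn (hmem _) hu
    rw [hT, projIcc_of_mem hlt ⟨h.strictMonoOn.monotoneOn hcI hu hu.1,
      h.strictMonoOn.monotoneOn hu h1I hu.2⟩]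
  have hmono : Monotone G := by
    intro s t hst
    rw [← h.strictMonoOn.le_iff_le (hmem s) (hmem t), hT, hT]
    exact monotone_projIcc hlt hst
  refine ⟨G, hmono, hmem, ?_, ?_, hinv, ?_, ?_⟩
  · intro t ht
    rw [← hinv c hcI]
    simp only [hG, projIcc_of_le_left hlt ht, projIcc_of_le_left hlt le_rfl]
  · intro t ht
    rw [← hinv 1 h1I]
    simp only [hG, projIcc_of_right_le hlt ht, projIcc_of_right_le hlt le_rfl]
  · intro t ht
    rw [hT, projIcc_of_mem hlt ht]
  · have hmono' : Monotone (fun t => (⟨G t, hmem t⟩ : Icc c 1)) := fun s t hst => hmono hst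
    have hsur' : Function.Surjective (fun t => (⟨G t, hmem t⟩ : Icc c 1)) := fun u =>
      ⟨travelTime F u, Subtype.ext (hinv u u.2)⟩
    exact continuous_subtype_val.comp (hmono'.continuous_of_surjective hsur')

end IsEnergy

namespace IsProfile

variable {F G : ℝ → ℝ} {c : ℝ}

theorem zero (hG : IsProfile F c G) (h : IsEnergy F c) : G 0 = 0 := by
  have := hG.leftInv 0 h.zero_mem
  rwa [IsEnergy.travelTime_zero] at this

theorem strictMonoOn (hG : IsProfile F c G) :
    StrictMonoOn G (Icc (travelTime F c) (travelTime F 1)) := by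
  intro s hs t ht hst
  refine lt_of_le_of_ne (hG.mono hst.le) fun he => ?_
  rw [← hG.rightInv s hs, ← hG.rightInv t ht, he] at hst
  exact lt_irrefl _ hst

theorem mem_Ioo (hG : IsProfile F c G) {t : ℝ}
    (ht : t ∈ Ioo (travelTime F c) (travelTime F 1)) : G t ∈ Ioo c 1 := by
  have htI := Ioo_subset_Icc_self ht
  have hlt := (ht.1.trans ht.2).le
  have h1 := hG.strictMonoOn (left_mem_Icc.2 hlt) htI ht.1
  have h2 := hG.strictMonoOn htI (right_mem_Icc.2 hlt) ht.2
  rw [hG.left _ le_rfl] at h1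
  rw [hG.right _ le_rfl] at h2
  exact ⟨h1, h2⟩

theorem hasDerivAt (hG : IsProfile F c G) (h : IsEnergy F c) {t : ℝ}
    (ht : t ∈ Ioo (travelTime F c) (travelTime F 1)) :
    HasDerivAt G (√(2 * F (G t))) t := by
  have hu := hG.mem_Ioo ht
  have hpos := h.pos _ (Ioo_subset_Ioc_self hu)
  have := HasDerivAt.of_local_left_inverse hG.cont.continuousAt (h.hasDerivAt hu)
    (by positivity) (by
      filter_upwards [isOpen_Ioo.mem_nhds ht] with s hs
      exact hG.rightInv s (Ioo_subset_Icc_self hs))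
  rwa [inv_inv] at this

theorem continuous_speed (hG : IsProfile F c G) (h : IsEnergy F c) :
    Continuous fun t => √(2 * F (G t)) :=
  Real.continuous_sqrt.comp (continuous_const.mul (h.cont.comp_continuous hG.cont hG.mem))

theorem hasDerivWithinAt (hG : IsProfile F c G) (h : IsEnergy F c) {t : ℝ}
    (ht : t ∈ Icc (travelTime F c) (travelTime F 1)) :
    HasDerivWithinAt G (√(2 * F (G t))) (Icc (travelTime F c) (travelTime F 1)) t :=
  hasDerivWithinAt_Icc_of_Ioo (f' := fun t => √(2 * F (G t)))
    (h.travelTime_neg.trans h.travelTime_pos) hG.cont.continuousOn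
    (fun _ hx => hG.hasDerivAt h hx) (hG.continuous_speed h).continuousOn ht

theorem hasDerivAt_speed {f : ℝ → ℝ} (hG : IsProfile F c G) (h : IsEnergy F c)
    (hf : ∀ u ∈ Ioo c 1, HasDerivAt F (f u) u) {t : ℝ}
    (ht : t ∈ Ioo (travelTime F c) (travelTime F 1)) :
    HasDerivAt (fun t => √(2 * F (G t))) (f (G t)) t := by
  have hu := hG.mem_Ioo ht
  have hpos := h.pos _ (Ioo_subset_Ioc_self hu)
  have h1 : HasDerivAt (fun s => F (G s)) (f (G t) * √(2 * F (G t))) t :=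
    (hf _ hu).comp t (hG.hasDerivAt h ht)
  have h2 := (h1.const_mul 2).sqrt (by positivity)
  refine h2.congr_deriv ?_
  have : 0 < √(2 * F (G t)) := by positivity
  field_simp

theorem deriv_deriv {f : ℝ → ℝ} (hG : IsProfile F c G) (h : IsEnergy F c)
    (hf : ∀ u ∈ Ioo c 1, HasDerivAt F (f u) u) {t : ℝ}
    (ht : t ∈ Ioo (travelTime F c) (travelTime F 1)) : deriv (deriv G) t = f (G t) := by
  rw [← (hG.hasDerivAt_speed h hf ht).deriv]
  apply Filter.EventuallyEq.deriv_eq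
  filter_upwards [isOpen_Ioo.mem_nhds ht] with s hs using (hG.hasDerivAt h hs).deriv

theorem contDiffOn {f : ℝ → ℝ} (hG : IsProfile F c G) (h : IsEnergy F c)
    (hf : ∀ u ∈ Ioo c 1, HasDerivAt F (f u) u) (hfc : ContinuousOn f (Icc c 1)) :
    ContDiffOn ℝ 2 G (Icc (travelTime F c) (travelTime F 1)) := by
  have hlt := h.travelTime_neg.trans h.travelTime_pos
  have hc : Continuous fun t => f (G t) := hfc.comp_continuous hG.cont hG.mem
  refine contDiffOn_two_Icc hlt (fun t ht => hG.hasDerivWithinAt h ht) (fun t ht => ?_)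
    hc.continuousOn
  exact hasDerivWithinAt_Icc_of_Ioo (f' := fun t => f (G t)) hlt
    (hG.continuous_speed h).continuousOn (fun _ hx => hG.hasDerivAt_speed h hf hx)
    hc.continuousOn ht

theorem hasDerivAt_left (hG : IsProfile F c G) (h : IsEnergy F c) :
    HasDerivAt G 0 (travelTime F c) := by
  have hlt := h.travelTime_neg.trans h.travelTime_pos
  have h1 : HasDerivWithinAt G 0 (Iic (travelTime F c)) (travelTime F c) :=
    (hasDerivWithinAt_const _ _ c).congr (fun s hs => hG.left s hs) (hG.left _ le_rfl)
  have h2 := hG.hasDerivWithinAt h (left_mem_Icc.2 hlt.le)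
  rw [hG.left _ le_rfl, h.zero, mul_zero, Real.sqrt_zero] at h2
  have h3 := h1.union h2
  refine h3.hasDerivAt ?_
  filter_upwards [Iio_mem_nhds hlt] with s hs
  rcases le_total s (travelTime F c) with h | h
  · exact Or.inl h
  · exact Or.inr ⟨h, le_of_lt hs⟩

theorem lipschitz (hG : IsProfile F c G) (h : IsEnergy F c) {M : ℝ}
    (hM : ∀ u ∈ Icc c 1, √(2 * F u) ≤ M) (s t : ℝ) : |G s - G t| ≤ M * |s - t| := by
  have hM0 : 0 ≤ M := (Real.sqrt_nonneg _).trans (hM 0 h.zero_mem)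
  have hlt := (h.travelTime_neg.trans h.travelTime_pos).le
  set p : ℝ → ℝ := fun s => projIcc _ _ hlt s with hp
  have hGp : ∀ s, G s = G (p s) := by
    intro s
    rcases le_total s (travelTime F c) with h1 | h1
    · simp only [hp, projIcc_of_le_left hlt h1]
      rw [hG.left s h1, hG.left _ le_rfl]
    rcases le_total (travelTime F 1) s with h2 | h2
    · simp only [hp, projIcc_of_right_le hlt h2]
      rw [hG.right s h2, hG.right _ le_rfl]
    · simp only [hp, projIcc_of_mem hlt ⟨h1, h2⟩]
  have hlip := (convex_Icc (travelTime F c) (travelTime F 1)).norm_image_sub_le_of_norm_hasDerivWithin_le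
    (f := G) (C := M) (fun x hx => hG.hasDerivWithinAt h hx) (fun x hx => by
      rw [Real.norm_of_nonneg (Real.sqrt_nonneg _)]
      exact hM _ (hG.mem x)) (projIcc _ _ hlt t).2 (projIcc _ _ hlt s).2
  rw [hGp s, hGp t]
  refine hlip.trans (mul_le_mul_of_nonneg_left ?_ hM0)
  exact abs_projIcc_sub_projIcc hlt

end IsProfile

namespace IsProfile

variable {F G : ℝ → ℝ} {c : ℝ}

theorem mem_Icc_of_core (hG : IsProfile F c G) (h : IsEnergy F c) {b s : ℝ} (hs : 0 < s)
    (hcb : c < -b) (hb1 : b < 1) (hb : 0 < b) (hbs : b ≤ s)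
    (hF : ∀ u ∈ Icc (-b) b, s ≤ √(2 * F u)) {t : ℝ} (ht : |G t| ≤ b) :
    t ∈ Icc (-1:ℝ) 1 := by
  have hlt := (h.travelTime_neg.trans h.travelTime_pos).le
  obtain ⟨h1, h2⟩ := abs_le.1 ht
  have htI : t ∈ Icc (travelTime F c) (travelTime F 1) := by
    constructor
    · by_contra! hcon
      rw [hG.left t hcon.le] at h1
      linarith
    · by_contra! hcon
      rw [hG.right t hcon.le] at h2
      linarith
  have hbI : b ∈ Icc c 1 := ⟨by linarith, hb1.le⟩
  have hbI' : -b ∈ Icc c 1 := ⟨hcb.le, by linarith⟩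
  have hmono := h.strictMonoOn.monotoneOn
  have e1 := hmono (hG.mem t) hbI h2
  have e2 := hmono hbI' (hG.mem t) h1
  rw [hG.rightInv t htI] at e1 e2
  have hw : ∀ u ∈ Icc (-b) b, (√(2 * F u))⁻¹ ≤ s⁻¹ := fun u hu =>
    inv_anti₀ hs (hF u hu)
  have hbs' : b * s⁻¹ ≤ 1 := by
    rw [← div_eq_mul_inv]; exact (div_le_one hs).2 hbs
  have i1 : travelTime F b - travelTime F 0 ≤ 1 := by
    rw [h.travelTime_sub h.zero_mem hbI]
    refine le_trans (intervalIntegral.integral_mono_on hb.le (h.int_sub h.zero_mem hbI)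
      intervalIntegrable_const (fun u hu => hw u ⟨by linarith [hu.1], hu.2⟩)) ?_
    simpa using hbs'
  have i2 : travelTime F 0 - travelTime F (-b) ≤ 1 := by
    rw [h.travelTime_sub hbI' h.zero_mem]
    refine le_trans (intervalIntegral.integral_mono_on (by linarith) (h.int_sub hbI' h.zero_mem)
      intervalIntegrable_const (fun u hu => hw u ⟨hu.1, by linarith [hu.2]⟩)) ?_
    simpa using hbs'
  rw [IsEnergy.travelTime_zero] at i1 i2
  constructor <;> linarith

theorem oneDViscIneq {f : ℝ → ℝ} (hG : IsProfile F c G) (h : IsEnergy F c)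
    (hf : ∀ u ∈ Ioo c 1, HasDerivAt F (f u) u) {n : ℕ} {W : ℝ → ℝ} {C Q b : ℝ}
    (hCQ : 0 ≤ C / Q) (hfc : ContinuousOn f (Icc c 1)) (hWc : 0 ≤ deriv W c) (hW1 : deriv W 1 = 0)
    (hout : ∀ u ∈ Ioo c 1, b ≤ |u| → f u + (2 * ((n:ℝ) - 1) / Q) * √(2 * F u) ≤ deriv W u)
    (hin : ∀ u ∈ Ioo c 1, |u| ≤ b →
      f u + (2 * ((n:ℝ) - 1) / Q) * √(2 * F u) ≤ deriv W u + C / Q)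
    (hcore : ∀ t, |G t| ≤ b → t ∈ Icc (-1:ℝ) 1) : OneDViscIneq n W C Q G := by
  have hlt := h.travelTime_neg.trans h.travelTime_pos
  have hind : ∀ t, 0 ≤ (C / Q) * indicator (Icc (-1:ℝ) 1) (fun _ => (1:ℝ)) t := fun t =>
    mul_nonneg hCQ (indicator_nonneg (fun _ _ => zero_le_one) t)
  have hle1 : ∀ s, G s ≤ 1 := fun s => (hG.mem s).2
  have hleft : ∀ ψ : ℝ → ℝ, ContDiffAt ℝ 2 ψ (travelTime F c) →
      deriv ψ (travelTime F c) = 0 → ψ (travelTime F c) = G (travelTime F c) →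
      (∀ s, ψ s ≤ G s) →
      deriv (deriv ψ) (travelTime F c) + (2 * ((n:ℝ) - 1) / Q) * deriv ψ (travelTime F c) ≤
        deriv W (G (travelTime F c)) +
          (C / Q) * indicator (Icc (-1:ℝ) 1) (fun _ => (1:ℝ)) (travelTime F c) := by
    intro ψ hψ hd he hle
    have h2 : deriv (deriv ψ) (travelTime F c) ≤ 0 := by
      refine deriv_deriv_nonpos_of_le_left hψ hd fun s hs => ?_
      rw [he, hG.left _ le_rfl, ← hG.left s hs]
      exact hle s
    rw [hd, mul_zero, add_zero]
    have := hind (travelTime F c)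
    rw [hG.left _ le_rfl]
    linarith
  have hright : ∀ ψ : ℝ → ℝ, ContDiffAt ℝ 2 ψ (travelTime F 1) →
      ψ (travelTime F 1) = G (travelTime F 1) → (∀ s, ψ s ≤ G s) →
      deriv (deriv ψ) (travelTime F 1) + (2 * ((n:ℝ) - 1) / Q) * deriv ψ (travelTime F 1) ≤
        deriv W (G (travelTime F 1)) +
          (C / Q) * indicator (Icc (-1:ℝ) 1) (fun _ => (1:ℝ)) (travelTime F 1) := by
    intro ψ hψ he hle
    have hmax : ∀ s, ψ s ≤ ψ (travelTime F 1) := fun s => by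
      rw [he, hG.right _ le_rfl]; exact (hle s).trans (hle1 s)
    have hd : deriv ψ (travelTime F 1) = 0 :=
      IsLocalMax.deriv_eq_zero (Eventually.of_forall hmax)
    have h2 := deriv_deriv_nonpos_of_le_left hψ hd fun s _ => hmax s
    rw [hd, mul_zero, add_zero]
    have := hind (travelTime F 1)
    rw [hG.right _ le_rfl, hW1]
    linarith
  intro t
  rcases lt_trichotomy t (travelTime F c) with ht | rfl | ht
  · have hev : G =ᶠ[nhds t] fun _ => c := by
      filter_upwards [Iio_mem_nhds ht] with s hs using hG.left s (le_of_lt hs)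
    have hcd : ContDiffAt ℝ 2 G t := contDiffAt_const.congr_of_eventuallyEq hev
    refine ⟨fun _ => ?_, fun hn => absurd hcd hn⟩
    rw [hev.deriv.deriv_eq, hev.deriv_eq, hG.left t ht.le]
    simp only [deriv_const', deriv_const, mul_zero, add_zero]
    linarith [hind t]
  · refine ⟨fun hcd => hleft G hcd (hG.hasDerivAt_left h).deriv rfl fun _ => le_rfl,
      fun _ ψ hψ he hle => hleft ψ hψ.contDiffAt ?_ he hle⟩
    have hψd : HasDerivAt ψ (deriv ψ (travelTime F c)) (travelTime F c) :=
      (hψ.contDiffAt.differentiableAt (by simp)).hasDerivAt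
    have hsub := (hG.hasDerivAt_left h).sub hψd
    have hmin : IsLocalMin (G - ψ) (travelTime F c) := Eventually.of_forall fun s => by
      simp only [Pi.sub_apply, he, sub_self]
      exact sub_nonneg.2 (hle s)
    have := hmin.hasDerivAt_eq_zero hsub
    linarith
  rcases lt_trichotomy t (travelTime F 1) with ht' | rfl | ht'
  · have hcd : ContDiffAt ℝ 2 G t :=
      (hG.contDiffOn h hf hfc).contDiffAt (Icc_mem_nhds ht ht')
    refine ⟨fun _ => ?_, fun hn => absurd hcd hn⟩
    rw [hG.deriv_deriv h hf ⟨ht, ht'⟩, (hG.hasDerivAt h ⟨ht, ht'⟩).deriv]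
    have hu := hG.mem_Ioo (t := t) ⟨ht, ht'⟩
    by_cases hb : |G t| ≤ b
    · rw [indicator_of_mem (hcore t hb), mul_one]
      exact hin _ hu hb
    · linarith [hout _ hu (not_le.1 hb).le, hind t]
  · exact ⟨fun hcd => hright G hcd rfl fun _ => le_rfl,
      fun _ ψ hψ he hle => hright ψ hψ.contDiffAt he hle⟩
  · have hev : G =ᶠ[nhds t] fun _ => 1 := by
      filter_upwards [Ioi_mem_nhds ht'] with s hs using hG.right s (le_of_lt hs)
    have hcd : ContDiffAt ℝ 2 G t := contDiffAt_const.congr_of_eventuallyEq hev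
    refine ⟨fun _ => ?_, fun hn => absurd hcd hn⟩
    rw [hev.deriv.deriv_eq, hev.deriv_eq, hG.right t ht'.le, hW1]
    simp only [deriv_const', deriv_const, mul_zero, add_zero]
    linarith [hind t]

end IsProfile

namespace DoubleWell

variable {W : ℝ → ℝ}

theorem reflect (hW : DoubleWell W) : DoubleWell fun u => W (-u) := by
  obtain ⟨h2, hm, hp, hpos, hdm, hdp, hddm, hddp⟩ := hW
  have hd : deriv (fun u => W (-u)) = fun u => -deriv W (-u) := by
    ext u; exact deriv_comp_neg W u
  have hdd : ∀ u, deriv (deriv fun u => W (-u)) u = deriv (deriv W) (-u) := by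
    intro u
    rw [hd, deriv.fun_neg, deriv_comp_neg (deriv W) u, neg_neg]
  refine ⟨h2.comp contDiff_neg.contDiffOn fun u hu => ⟨by linarith [hu.2], by linarith [hu.1]⟩,
    by simpa using hp, by simpa using hm,
    fun s hs => hpos _ ⟨by linarith [hs.2], by linarith [hs.1]⟩, by simp [hd, hdp],
    by simp [hd, hdm], by simpa [hdd] using hddp, by simpa [hdd] using hddm⟩

theorem contDiffAt (hW : DoubleWell W) {u : ℝ} (hu : u ∈ Ioo (-1:ℝ) 1) : ContDiffAt ℝ 2 W u :=
  hW.1.contDiffAt (Icc_mem_nhds hu.1 hu.2)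

theorem hasDerivAt (hW : DoubleWell W) {u : ℝ} (hu : u ∈ Ioo (-1:ℝ) 1) :
    HasDerivAt W (deriv W u) u :=
  ((hW.contDiffAt hu).differentiableAt (by simp)).hasDerivAt

theorem continuousOn_deriv (hW : DoubleWell W) : ContinuousOn (deriv W) (Icc (-1) 1) := by
  intro u hu
  apply ContinuousAt.continuousWithinAt
  rcases eq_or_lt_of_le hu.1 with rfl | h1
  · exact (differentiableAt_of_deriv_ne_zero hW.2.2.2.2.2.2.1.ne').continuousAt
  rcases eq_or_lt_of_le hu.2 with rfl | h2
  · exact (differentiableAt_of_deriv_ne_zero hW.2.2.2.2.2.2.2.ne').continuousAt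
  · have h := (hW.1.mono Ioo_subset_Icc_self).continuousOn_deriv_of_isOpen isOpen_Ioo (by simp)
    exact h.continuousAt (isOpen_Ioo.mem_nhds ⟨h1, h2⟩)

theorem deriv_near_left (hW : DoubleWell W) : ∃ d κ L : ℝ, 0 < d ∧ d ≤ 1 / 2 ∧ 0 < κ ∧
    ∀ u ∈ Icc (-1:ℝ) (-1 + d), κ * (1 + u) ≤ deriv W u ∧ deriv W u ≤ L * (1 + u) := by
  obtain ⟨-, -, -, -, hdm, -, hdd, -⟩ := hW
  set L := deriv (deriv W) (-1) with hL
  have hder : HasDerivAt (deriv W) L (-1) := (differentiableAt_of_deriv_ne_zero hdd.ne').hasDerivAt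
  have h := hder.isLittleO.def (half_pos hdd)
  obtain ⟨ε, hε, hball⟩ := Metric.eventually_nhds_iff.1 h
  refine ⟨min (ε / 2) (1 / 2), L / 2, 3 * L / 2, by positivity, min_le_right _ _, by positivity,
    fun u hu => ?_⟩
  have hd : min (ε / 2) (1 / 2) ≤ ε / 2 := min_le_left _ _
  have hu0 : 0 ≤ u + 1 := by linarith [hu.1]
  have := hball (y := u) (by
    rw [Real.dist_eq, sub_neg_eq_add, abs_of_nonneg hu0]
    linarith [hu.2])
  simp only [hdm, sub_zero, sub_neg_eq_add, smul_eq_mul, Real.norm_eq_abs,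
    abs_of_nonneg hu0] at this
  obtain ⟨h1, h2⟩ := abs_le.1 this
  constructor <;> nlinarith

theorem quadratic_left (hW : DoubleWell W) : ∃ l L : ℝ, 0 < l ∧ 0 < L ∧
    ∀ u ∈ Icc (-1:ℝ) 0, l * (1 + u) ^ 2 ≤ W u ∧ W u ≤ L * (1 + u) ^ 2 := by
  obtain ⟨d, κ, L, hd, hd1, hκ, hder⟩ := hW.deriv_near_left
  have hcont : ContinuousOn W (Icc (-1) 1) := hW.1.continuousOn
  have hq : ∀ A u : ℝ, HasDerivAt (fun u : ℝ => A / 2 * (1 + u) ^ 2) (A * (1 + u)) u := by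
    intro A u
    have := (((hasDerivAt_id u).const_add 1).pow 2).const_mul (A / 2)
    refine this.congr_deriv ?_
    simp only [id]; ring
  have hnear : ∀ u ∈ Icc (-1:ℝ) (-1 + d),
      κ / 2 * (1 + u) ^ 2 ≤ W u ∧ W u ≤ L / 2 * (1 + u) ^ 2 := by
    have hsub : Icc (-1:ℝ) (-1 + d) ⊆ Icc (-1) 1 := Icc_subset_Icc_right (by linarith)
    have hIoo : ∀ u ∈ interior (Icc (-1:ℝ) (-1 + d)), u ∈ Ioo (-1:ℝ) 1 := by
      intro u hu
      rw [interior_Icc] at hu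
      exact ⟨hu.1, by linarith [hu.2]⟩
    have hl : (-1:ℝ) ∈ Icc (-1:ℝ) (-1 + d) := left_mem_Icc.2 (by linarith)
    have hqc : ∀ A : ℝ, ContinuousOn (fun u : ℝ => A / 2 * (1 + u) ^ 2) (Icc (-1) (-1 + d)) :=
      fun A u _ => (hq A u).continuousAt.continuousWithinAt
    have m1 : MonotoneOn (fun u => W u - κ / 2 * (1 + u) ^ 2) (Icc (-1:ℝ) (-1 + d)) := by
      apply monotoneOn_of_hasDerivWithinAt_nonneg (convex_Icc _ _) ((hcont.mono hsub).sub (hqc κ))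
        (fun u hu => ((hW.hasDerivAt (hIoo u hu)).sub (hq κ u)).hasDerivWithinAt)
      intro u hu
      linarith [(hder u (interior_subset hu)).1]
    have m2 : MonotoneOn (fun u => L / 2 * (1 + u) ^ 2 - W u) (Icc (-1:ℝ) (-1 + d)) := by
      apply monotoneOn_of_hasDerivWithinAt_nonneg (convex_Icc _ _) ((hqc L).sub (hcont.mono hsub))
        (fun u hu => ((hq L u).sub (hW.hasDerivAt (hIoo u hu))).hasDerivWithinAt)
      intro u hu
      linarith [(hder u (interior_subset hu)).2]
    intro u hu
    have e1 := m1 hl hu hu.1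
    have e2 := m2 hl hu hu.1
    simp only [hW.2.1] at e1 e2
    norm_num at e1 e2
    exact ⟨e1, e2⟩
  have hsub : Icc (-1 + d) 0 ⊆ Icc (-1:ℝ) 1 := Icc_subset_Icc (by linarith) zero_le_one
  have hne : (Icc (-1 + d) (0:ℝ)).Nonempty := nonempty_Icc.2 (by linarith)
  obtain ⟨u₁, hu₁, hmin⟩ := isCompact_Icc.exists_isMinOn hne (hcont.mono hsub)
  obtain ⟨u₂, hu₂, hmax⟩ := isCompact_Icc.exists_isMaxOn hne (hcont.mono hsub)
  have hp₁ : 0 < W u₁ := hW.2.2.2.1 u₁ ⟨by linarith [hu₁.1], by linarith [hu₁.2]⟩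
  have hp₂ : 0 < W u₂ := hW.2.2.2.1 u₂ ⟨by linarith [hu₂.1], by linarith [hu₂.2]⟩
  refine ⟨min (κ / 2) (W u₁), max (L / 2) (W u₂ / d ^ 2), by positivity,
    lt_max_of_lt_right (by positivity), fun u hu => ?_⟩
  have hsq : 0 ≤ (1 + u) ^ 2 := sq_nonneg _
  rcases le_total u (-1 + d) with h | h
  · obtain ⟨e1, e2⟩ := hnear u ⟨hu.1, h⟩
    exact ⟨(mul_le_mul_of_nonneg_right (min_le_left _ _) hsq).trans e1,
      e2.trans (mul_le_mul_of_nonneg_right (le_max_left _ _) hsq)⟩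
  · have e1 : W u₁ ≤ W u := hmin ⟨h, hu.2⟩
    have e2 : W u ≤ W u₂ := hmax ⟨h, hu.2⟩
    constructor
    · refine le_trans ?_ e1
      refine (mul_le_mul_of_nonneg_right (min_le_right _ _) hsq).trans ?_
      have : (1 + u) ^ 2 ≤ 1 := by nlinarith [hu.1, hu.2]
      nlinarith
    · refine e2.trans (le_trans ?_ (mul_le_mul_of_nonneg_right (le_max_right _ _) hsq))
      rw [div_mul_eq_mul_div, le_div_iff₀ (by positivity)]
      exact mul_le_mul_of_nonneg_left (by nlinarith) hp₂.le

theorem quadratic (hW : DoubleWell W) : ∃ l L : ℝ, 0 < l ∧ 1 ≤ L ∧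
    ∀ u ∈ Icc (-1:ℝ) 1, l * (1 - |u|) ^ 2 ≤ W u ∧ W u ≤ L * (1 - |u|) ^ 2 := by
  obtain ⟨l₁, L₁, hl₁, hL₁, h₁⟩ := hW.quadratic_left
  obtain ⟨l₂, L₂, hl₂, hL₂, h₂⟩ := hW.reflect.quadratic_left
  refine ⟨min l₁ l₂, max (max L₁ L₂) 1, by positivity, le_max_right _ _, fun u hu => ?_⟩
  have hsq : 0 ≤ (1 - |u|) ^ 2 := sq_nonneg _
  have hL₁' : L₁ ≤ max (max L₁ L₂) 1 := (le_max_left _ _).trans (le_max_left _ _)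
  have hL₂' : L₂ ≤ max (max L₁ L₂) 1 := (le_max_right _ _).trans (le_max_left _ _)
  rcases le_total u 0 with h | h
  · obtain ⟨e1, e2⟩ := h₁ u ⟨hu.1, h⟩
    rw [show 1 + u = 1 - |u| by rw [abs_of_nonpos h]; ring] at e1 e2
    exact ⟨(mul_le_mul_of_nonneg_right (min_le_left _ _) hsq).trans e1,
      e2.trans (mul_le_mul_of_nonneg_right hL₁' hsq)⟩
  · obtain ⟨e1, e2⟩ := h₂ (-u) ⟨by linarith [hu.2], by linarith⟩
    rw [show 1 + -u = 1 - |u| by rw [abs_of_nonneg h]; ring, neg_neg] at e1 e2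
    exact ⟨(mul_le_mul_of_nonneg_right (min_le_right _ _) hsq).trans e1,
      e2.trans (mul_le_mul_of_nonneg_right hL₂' hsq)⟩

end DoubleWell

/-- The one-dimensional solution has zero energy. -/
theorem IsOneDSolution.deriv_eq {W g : ℝ → ℝ} (hW : DoubleWell W) (hg : IsOneDSolution W g)
    (t : ℝ) : deriv g t = √(2 * W (g t)) := by
  obtain ⟨hc2, hmem, hode, hpos, h0, htop, -⟩ := hg
  have hdiff : Differentiable ℝ g := hc2.differentiable (by simp)
  have hdiff' : Differentiable ℝ (deriv g) :=
    (contDiff_succ_iff_deriv.1 (show ContDiff ℝ (1 + 1) g from hc2)).2.2.differentiable (by simp)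
  have hE : ∀ t, HasDerivAt (fun t => deriv g t ^ 2 - 2 * W (g t)) 0 t := by
    intro t
    have h1 := (hdiff' t).hasDerivAt.pow 2
    have h2 := ((hW.hasDerivAt (hmem t)).comp t (hdiff t).hasDerivAt).const_mul 2
    refine (h1.sub h2).congr_deriv ?_
    rw [hode t]; ring
  have hconst : ∀ s, deriv g s ^ 2 - 2 * W (g s) = deriv g t ^ 2 - 2 * W (g t) := fun s =>
    is_const_of_deriv_eq_zero (fun s => (hE s).differentiableAt) (fun s => (hE s).deriv) s t
  set e := deriv g t ^ 2 - 2 * W (g t) with he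
  have hWpos : ∀ s, 0 < W (g s) := fun s => hW.2.2.2.1 _ (hmem s)
  have he_nonpos : e ≤ 0 := by
    by_contra! hcon
    have hs : 0 < √e := Real.sqrt_pos.2 hcon
    have hlow : ∀ s, √e ≤ deriv g s := fun s =>
      Real.sqrt_le_iff.2 ⟨(hpos s).le, by linarith [hconst s, hWpos s]⟩
    have := mul_sub_le_image_sub_of_le_deriv hdiff hlow (inv_pos.2 hs).le
    rw [sub_zero, mul_inv_cancel₀ hs.ne', h0, sub_zero] at this
    linarith [(hmem (√e)⁻¹).2]
  have he_nonneg : 0 ≤ e := by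
    have hWcont : Tendsto (fun s => W (g s)) atTop (nhds 0) := by
      have h1 : ContinuousWithinAt W (Icc (-1) 1) 1 := hW.1.continuousOn 1 (by simp)
      have h2 : Tendsto g atTop (nhdsWithin 1 (Icc (-1) 1)) :=
        tendsto_nhdsWithin_iff.2 ⟨htop, Eventually.of_forall fun s => Ioo_subset_Icc_self (hmem s)⟩
      have := Tendsto.comp h1 h2
      rwa [hW.2.2.1] at this
    have h3 : Tendsto (fun s => -(2 * W (g s))) atTop (nhds 0) := by
      simpa using (hWcont.const_mul 2).neg
    exact le_of_tendsto' h3 fun s => by nlinarith [hconst s, sq_nonneg (deriv g s)]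
  rw [show 2 * W (g t) = deriv g t ^ 2 by linarith, Real.sqrt_sq (hpos t).le]

/-- A smooth step from `0` on `(-∞, 0]` to `1` on `[b, ∞)`. -/
def cutoff (b u : ℝ) : ℝ := Real.smoothTransition (u / b)

theorem contDiff_cutoff (b : ℝ) : ContDiff ℝ 1 (cutoff b) :=
  Real.smoothTransition.contDiff.comp (contDiff_id.div_const b)

theorem cutoff_nonneg (b u : ℝ) : 0 ≤ cutoff b u := Real.smoothTransition.nonneg _

theorem cutoff_le_one (b u : ℝ) : cutoff b u ≤ 1 := Real.smoothTransition.le_one _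

theorem cutoff_of_nonpos {b u : ℝ} (hb : 0 < b) (hu : u ≤ 0) : cutoff b u = 0 :=
  Real.smoothTransition.zero_of_nonpos (div_nonpos_of_nonpos_of_nonneg hu hb.le)

theorem cutoff_of_le {b u : ℝ} (hb : 0 < b) (hu : b ≤ u) : cutoff b u = 1 :=
  Real.smoothTransition.one_of_one_le ((one_le_div hb).2 hu)

theorem deriv_cutoff_of_nonpos {b u : ℝ} (hb : 0 < b) (hu : u ≤ 0) : deriv (cutoff b) u = 0 := by
  apply IsLocalMin.deriv_eq_zero
  exact Eventually.of_forall fun v => by rw [cutoff_of_nonpos hb hu]; exact cutoff_nonneg b v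

theorem deriv_cutoff_of_le {b u : ℝ} (hb : 0 < b) (hu : b ≤ u) : deriv (cutoff b) u = 0 := by
  apply IsLocalMax.deriv_eq_zero
  exact Eventually.of_forall fun v => by rw [cutoff_of_le hb hu]; exact cutoff_le_one b v

theorem continuous_deriv_cutoff (b : ℝ) : Continuous (deriv (cutoff b)) :=
  (contDiff_cutoff b).continuous_deriv le_rfl

/-- Odd perturbation of the potential, increasing in the core `|u| < b` and equal to
`± (1 + η - |u|)²` outside. -/
def bump (b η u : ℝ) : ℝ := cutoff b u * (1 + η - u) ^ 2 - cutoff b (-u) * (1 + η + u) ^ 2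

def bumpDeriv (b η u : ℝ) : ℝ :=
  deriv (cutoff b) u * (1 + η - u) ^ 2 - 2 * (cutoff b u * (1 + η - u)) +
    deriv (cutoff b) (-u) * (1 + η + u) ^ 2 - 2 * (cutoff b (-u) * (1 + η + u))

theorem hasDerivAt_bump (b η u : ℝ) : HasDerivAt (bump b η) (bumpDeriv b η u) u := by
  have hS : ∀ v, HasDerivAt (cutoff b) (deriv (cutoff b) v) v := fun v =>
    (((contDiff_cutoff b).differentiable (by simp)) v).hasDerivAt
  have h1 := (hS u).mul (((hasDerivAt_id u).const_sub (1 + η)).pow 2)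
  have h2 := ((hS (-u)).comp u (hasDerivAt_neg u)).mul (((hasDerivAt_id u).const_add (1 + η)).pow 2)
  refine (h1.sub h2).congr_deriv ?_
  simp only [bumpDeriv, Function.comp_apply, id, Pi.pow_apply]
  ring

theorem continuous_bump (b η : ℝ) : Continuous (bump b η) :=
  continuous_iff_continuousAt.2 fun u => (hasDerivAt_bump b η u).continuousAt

theorem continuous_bumpDeriv (b η : ℝ) : Continuous (bumpDeriv b η) := by
  have h1 := continuous_deriv_cutoff b
  have h2 := (contDiff_cutoff b).continuous
  unfold bumpDeriv
  fun_prop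

theorem bump_of_nonneg {b u : ℝ} (hb : 0 < b) (η : ℝ) (hu : 0 ≤ u) :
    bump b η u = cutoff b u * (1 + η - |u|) ^ 2 := by
  rw [bump, cutoff_of_nonpos hb (neg_nonpos.2 hu), abs_of_nonneg hu]; ring

theorem bump_of_nonpos {b u : ℝ} (hb : 0 < b) (η : ℝ) (hu : u ≤ 0) :
    bump b η u = -(cutoff b (-u) * (1 + η - |u|) ^ 2) := by
  rw [bump, cutoff_of_nonpos hb hu, abs_of_nonpos hu]; ring

theorem abs_bump_le {b : ℝ} (hb : 0 < b) (η u : ℝ) : |bump b η u| ≤ (1 + η - |u|) ^ 2 := by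
  have hsq : 0 ≤ (1 + η - |u|) ^ 2 := sq_nonneg _
  rcases le_total 0 u with h | h
  · rw [bump_of_nonneg hb η h, abs_of_nonneg (mul_nonneg (cutoff_nonneg _ _) hsq)]
    exact mul_le_of_le_one_left hsq (cutoff_le_one _ _)
  · rw [bump_of_nonpos hb η h, abs_neg, abs_of_nonneg (mul_nonneg (cutoff_nonneg _ _) hsq)]
    exact mul_le_of_le_one_left hsq (cutoff_le_one _ _)

theorem bumpDeriv_of_le {b u : ℝ} (hb : 0 < b) (η : ℝ) (hu : b ≤ |u|) :
    bumpDeriv b η u = -(2 * (1 + η - |u|)) := by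
  rcases le_total 0 u with h | h
  · rw [abs_of_nonneg h] at hu ⊢
    rw [bumpDeriv, deriv_cutoff_of_le hb hu, cutoff_of_le hb hu,
      deriv_cutoff_of_nonpos hb (neg_nonpos.2 h), cutoff_of_nonpos hb (neg_nonpos.2 h)]
    ring
  · rw [abs_of_nonpos h] at hu ⊢
    rw [bumpDeriv, deriv_cutoff_of_le hb hu, cutoff_of_le hb hu,
      deriv_cutoff_of_nonpos hb h, cutoff_of_nonpos hb h]
    ring

theorem bumpDeriv_le {b η u B : ℝ} (hη : 0 ≤ η) (hη1 : η ≤ 1) (hu : u ∈ Icc (-1:ℝ) 1)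
    (hB : ∀ v ∈ Icc (-1:ℝ) 1, |deriv (cutoff b) v| ≤ B) : bumpDeriv b η u ≤ 18 * B := by
  have h1 := (abs_le.1 (hB u hu)).2
  have h2 := (abs_le.1 (hB (-u) ⟨by linarith [hu.2], by linarith [hu.1]⟩)).2
  have hB0 : 0 ≤ B := (abs_nonneg _).trans (hB u hu)
  have s1 : (1 + η - u) ^ 2 ≤ 9 := by nlinarith [hu.1, hu.2]
  have s2 : (1 + η + u) ^ 2 ≤ 9 := by nlinarith [hu.1, hu.2]
  have e1 : deriv (cutoff b) u * (1 + η - u) ^ 2 ≤ B * 9 :=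
    (mul_le_mul_of_nonneg_right h1 (sq_nonneg _)).trans (mul_le_mul_of_nonneg_left s1 hB0)
  have e2 : deriv (cutoff b) (-u) * (1 + η + u) ^ 2 ≤ B * 9 :=
    (mul_le_mul_of_nonneg_right h2 (sq_nonneg _)).trans (mul_le_mul_of_nonneg_left s2 hB0)
  have e3 : 0 ≤ cutoff b u * (1 + η - u) :=
    mul_nonneg (cutoff_nonneg _ _) (by linarith [hu.2])
  have e4 : 0 ≤ cutoff b (-u) * (1 + η + u) :=
    mul_nonneg (cutoff_nonneg _ _) (by linarith [hu.1])
  unfold bumpDeriv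
  linarith

/-- The constants attached to a double-well potential `W` and a drift coefficient `D`. -/
structure WellData (W : ℝ → ℝ) (D d l L κ b B K : ℝ) : Prop where
  well : DoubleWell W
  D_nonneg : 0 ≤ D
  d_pos : 0 < d
  d_le : d ≤ 1 / 2
  l_pos : 0 < l
  one_le_L : 1 ≤ L
  lower : ∀ u ∈ Icc (-1:ℝ) 1, l * (1 - |u|) ^ 2 ≤ W u
  upper : ∀ u ∈ Icc (-1:ℝ) 1, W u ≤ L * (1 - |u|) ^ 2
  κ_pos : 0 < κ
  slope : ∀ u ∈ Icc (-1:ℝ) (-1 + d), κ * (1 + u) ≤ deriv W u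
  b_pos : 0 < b
  b_le : b ≤ 1 / 2
  b_le_sqrt : b ≤ √l / 2
  cut : ∀ u ∈ Icc (-1:ℝ) 1, |deriv (cutoff b) u| ≤ B
  one_le_K : 1 ≤ K
  K_ge : D * (L + 1) ≤ 2 * K

theorem DoubleWell.exists_wellData {W : ℝ → ℝ} (hW : DoubleWell W) {D r : ℝ} (hD : 0 ≤ D)
    (hr : 0 < r) : ∃ d l L κ b B K : ℝ, d ≤ r ∧ WellData W D d l L κ b B K := by
  obtain ⟨l, L, hl, hL, hq⟩ := hW.quadratic
  obtain ⟨d, κ, _, hd, hd1, hκ, hs⟩ := hW.deriv_near_left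
  set b : ℝ := min (1 / 2) (√l / 2) with hb
  obtain ⟨B, hB⟩ := isCompact_Icc.exists_bound_of_continuousOn
    (continuous_deriv_cutoff b).continuousOn (s := Icc (-1:ℝ) 1)
  refine ⟨min d r, l, L, κ, b, B, D * (L + 1) + 1, min_le_right _ _, ?_⟩
  have hDL : 0 ≤ D * (L + 1) := by positivity
  exact
    { well := hW
      D_nonneg := hD
      d_pos := lt_min hd hr
      d_le := (min_le_left _ _).trans hd1
      l_pos := hl
      one_le_L := hL
      lower := fun u hu => (hq u hu).1
      upper := fun u hu => (hq u hu).2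
      κ_pos := hκ
      slope := fun u hu => (hs u ⟨hu.1, hu.2.trans (by linarith [min_le_left d r])⟩).1
      b_pos := by positivity
      b_le := min_le_left _ _
      b_le_sqrt := min_le_right _ _
      cut := hB
      one_le_K := by linarith
      K_ge := by linarith }

/-- The perturbed energy. -/
def energy (W : ℝ → ℝ) (b K ε η u : ℝ) : ℝ := W u + ε * K * bump b η u

/-- Smallness of the perturbation parameter. -/
structure SmallParam (d l L κ K ε : ℝ) : Prop where
  pos : 0 < ε
  le_one : ε * K ≤ 1
  le_depth : 8 * (ε * K) ≤ l * d ^ 2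
  le_slope : 16 * L ^ 2 * (ε * K) ≤ κ ^ 2

namespace WellData

variable {W : ℝ → ℝ} {D d l L κ b B K ε η : ℝ}

theorem exists_small (P : WellData W D d l L κ b B K) :
    ∃ ε₀ : ℝ, 0 < ε₀ ∧ ∀ ε, 0 < ε → ε ≤ ε₀ → SmallParam d l L κ K ε := by
  have hK : 0 < K := one_pos.trans_le P.one_le_K
  have hL : 0 < L := one_pos.trans_le P.one_le_L
  have hd := P.d_pos
  have hl := P.l_pos
  have hκ := P.κ_pos
  refine ⟨min 1 (min (l * d ^ 2 / 8) (κ ^ 2 / (16 * L ^ 2))) / K, by positivity,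
    fun ε h0 hle => ?_⟩
  rw [le_div_iff₀ hK] at hle
  have h1 := hle.trans (min_le_left _ _)
  have h2 := (hle.trans (min_le_right _ _)).trans (min_le_left _ _)
  have h3 := (hle.trans (min_le_right _ _)).trans (min_le_right _ _)
  rw [le_div_iff₀ (by positivity)] at h3
  exact ⟨h0, h1, by linarith, by linarith⟩

theorem energy_hasDerivAt (P : WellData W D d l L κ b B K) (ε η : ℝ) {u : ℝ}
    (hu : u ∈ Ioo (-1:ℝ) 1) :
    HasDerivAt (energy W b K ε η) (deriv W u + ε * K * bumpDeriv b η u) u :=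
  (P.well.hasDerivAt hu).add ((hasDerivAt_bump b η u).const_mul _)

theorem energy_continuousOn (P : WellData W D d l L κ b B K) (ε η : ℝ) :
    ContinuousOn (energy W b K ε η) (Icc (-1) 1) :=
  P.well.1.continuousOn.add (continuous_const.mul (continuous_bump b η)).continuousOn

theorem energyDeriv_continuousOn (P : WellData W D d l L κ b B K) (ε η : ℝ) :
    ContinuousOn (fun u => deriv W u + ε * K * bumpDeriv b η u) (Icc (-1) 1) :=
  P.well.continuousOn_deriv.add (continuous_const.mul (continuous_bumpDeriv b η)).continuousOn

theorem abs_energy_sub_le (P : WellData W D d l L κ b B K) (hε : 0 ≤ ε) (η u : ℝ) :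
    |energy W b K ε η u - W u| ≤ ε * K * (1 + η - |u|) ^ 2 := by
  have hK : 0 ≤ K := zero_le_one.trans P.one_le_K
  have hεK : 0 ≤ ε * K := mul_nonneg hε hK
  rw [energy, add_sub_cancel_left, abs_mul, abs_of_nonneg hεK]
  exact mul_le_mul_of_nonneg_left (abs_bump_le P.b_pos η u) hεK

theorem le_energy_of_nonneg (P : WellData W D d l L κ b B K) (hε : 0 ≤ ε) (η : ℝ) {u : ℝ}
    (hu : 0 ≤ u) : W u ≤ energy W b K ε η u := by
  have hK : 0 ≤ K := zero_le_one.trans P.one_le_K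
  rw [energy, bump_of_nonneg P.b_pos η hu]
  have := mul_nonneg (mul_nonneg hε hK) (mul_nonneg (cutoff_nonneg b u) (sq_nonneg (1 + η - |u|)))
  linarith

theorem energy_le_of_nonpos (P : WellData W D d l L κ b B K) (hε : 0 ≤ ε) (η : ℝ) {u : ℝ}
    (hu : u ≤ 0) : energy W b K ε η u ≤ W u := by
  have hK : 0 ≤ K := zero_le_one.trans P.one_le_K
  rw [energy, bump_of_nonpos P.b_pos η hu]
  have := mul_nonneg (mul_nonneg hε hK)
    (mul_nonneg (cutoff_nonneg b (-u)) (sq_nonneg (1 + η - |u|)))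
  linarith

theorem sqrt_energy_le (P : WellData W D d l L κ b B K) (hε : SmallParam d l L κ K ε)
    (hη : 0 ≤ η) {u : ℝ} (hu : u ∈ Icc (-1:ℝ) 1) :
    √(2 * energy W b K ε η u) ≤ (L + 1) * (1 + η - |u|) := by
  have hy : 0 ≤ 1 - |u| := sub_nonneg.2 (abs_le.2 hu)
  have hL := P.one_le_L
  apply Real.sqrt_le_iff.2
  refine ⟨mul_nonneg (by linarith) (by linarith), ?_⟩
  have h1 := (abs_le.1 (P.abs_energy_sub_le hε.pos.le η u)).2
  have h2 := P.upper u hu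
  have h3 : L * (1 - |u|) ^ 2 ≤ L * (1 + η - |u|) ^ 2 :=
    mul_le_mul_of_nonneg_left (by nlinarith) (by linarith)
  have h4 : ε * K * (1 + η - |u|) ^ 2 ≤ 1 * (1 + η - |u|) ^ 2 :=
    mul_le_mul_of_nonneg_right hε.le_one (sq_nonneg _)
  have h5 : 2 * (L + 1) * (1 + η - |u|) ^ 2 ≤ (L + 1) ^ 2 * (1 + η - |u|) ^ 2 :=
    mul_le_mul_of_nonneg_right (by nlinarith) (sq_nonneg _)
  rw [mul_pow]
  linarith

theorem drift_outside (P : WellData W D d l L κ b B K) (hε : SmallParam d l L κ K ε)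
    (hη : 0 ≤ η) {u : ℝ} (hu : u ∈ Icc (-1:ℝ) 1) (hb : b ≤ |u|) :
    deriv W u + ε * K * bumpDeriv b η u + D * ε * √(2 * energy W b K ε η u) ≤ deriv W u := by
  rw [bumpDeriv_of_le P.b_pos η hb]
  have hy : 0 ≤ 1 - |u| := sub_nonneg.2 (abs_le.2 hu)
  have hDε : 0 ≤ D * ε := mul_nonneg P.D_nonneg hε.pos.le
  have h1 := mul_le_mul_of_nonneg_left (P.sqrt_energy_le hε hη hu) hDε
  have h2 : 0 ≤ ε * (1 + η - |u|) * (2 * K - D * (L + 1)) :=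
    mul_nonneg (mul_nonneg hε.pos.le (by linarith)) (by linarith [P.K_ge])
  linarith

theorem drift_inside (P : WellData W D d l L κ b B K) (hε : SmallParam d l L κ K ε)
    (hη : 0 ≤ η) (hη1 : η ≤ 1) {u : ℝ} (hu : u ∈ Icc (-1:ℝ) 1) :
    deriv W u + ε * K * bumpDeriv b η u + D * ε * √(2 * energy W b K ε η u) ≤
      deriv W u + (18 * B * K + 4 * K) * ε := by
  have hK : 0 ≤ K := zero_le_one.trans P.one_le_K
  have hL := P.one_le_L
  have hDε : 0 ≤ D * ε := mul_nonneg P.D_nonneg hε.pos.le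
  have h0 : (L + 1) * (1 + η - |u|) ≤ (L + 1) * 2 :=
    mul_le_mul_of_nonneg_left (by linarith [abs_nonneg u]) (by linarith)
  have h1 := mul_le_mul_of_nonneg_left ((P.sqrt_energy_le hε hη hu).trans h0) hDε
  have h2 := mul_le_mul_of_nonneg_left (bumpDeriv_le hη hη1 hu P.cut) (mul_nonneg hε.pos.le hK)
  have h3 := mul_le_mul_of_nonneg_right P.K_ge hε.pos.le
  linarith

end WellData

namespace WellData

variable {W : ℝ → ℝ} {D d l L κ b B K ε η c : ℝ}

theorem core_lower (P : WellData W D d l L κ b B K) (hε : SmallParam d l L κ K ε)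
    (hη : 0 ≤ η) (hη1 : η ≤ 1) {u : ℝ} (hu : u ∈ Icc (-1 + d) 0) :
    l * (1 - |u|) ^ 2 - l * d ^ 2 / 2 ≤ energy W b K ε η u := by
  have hd := P.d_pos
  have hd1 := P.d_le
  have hK : 0 ≤ K := zero_le_one.trans P.one_le_K
  have hu' : u ∈ Icc (-1:ℝ) 1 := ⟨by linarith [hu.1], by linarith [hu.2]⟩
  have h1 := (abs_le.1 (P.abs_energy_sub_le hε.pos.le η u)).1
  have h2 := P.lower u hu'
  have hy : 0 ≤ 1 - |u| := sub_nonneg.2 (abs_le.2 hu')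
  have h3 : (1 + η - |u|) ^ 2 ≤ 4 := by nlinarith [abs_nonneg u]
  have h4 := mul_le_mul_of_nonneg_left h3 (mul_nonneg hε.pos.le hK)
  linarith [hε.le_depth]

theorem core_lower' (P : WellData W D d l L κ b B K) (hε : SmallParam d l L κ K ε)
    (hη : 0 ≤ η) (hη1 : η ≤ 1) {u : ℝ} (hu : u ∈ Icc (-1 + d) 0) :
    l * d ^ 2 / 2 ≤ energy W b K ε η u := by
  have h := P.core_lower hε hη hη1 hu
  have hy : d ≤ 1 - |u| := by rw [abs_of_nonpos hu.2]; linarith [hu.1]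
  have : l * d ^ 2 ≤ l * (1 - |u|) ^ 2 :=
    mul_le_mul_of_nonneg_left (pow_le_pow_left₀ P.d_pos.le hy 2) P.l_pos.le
  linarith

theorem speed_core (P : WellData W D d l L κ b B K) (hε : SmallParam d l L κ K ε)
    (hη : 0 ≤ η) (hη1 : η ≤ 1) {u : ℝ} (hu : u ∈ Icc (-b) b) :
    √l / 2 ≤ √(2 * energy W b K ε η u) := by
  have hl := P.l_pos
  have hd := P.d_pos
  have hd1 := P.d_le
  have hb1 := P.b_le
  have habs : |u| ≤ 1 / 2 := (abs_le.2 hu).trans hb1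
  have hq : l * (1 / 4) ≤ l * (1 - |u|) ^ 2 :=
    mul_le_mul_of_nonneg_left (by nlinarith) hl.le
  have hkey : l / 8 ≤ energy W b K ε η u := by
    rcases le_total 0 u with h | h
    · have := P.le_energy_of_nonneg hε.pos.le η h
      have := P.lower u ⟨by linarith, by linarith [hu.2]⟩
      linarith
    · have := P.core_lower hε hη hη1 (u := u) ⟨by linarith [hu.1], h⟩
      have : l * d ^ 2 ≤ l * (1 / 4) := mul_le_mul_of_nonneg_left (by nlinarith) hl.le
      linarith
  apply Real.le_sqrt_of_sq_le
  rw [div_pow, Real.sq_sqrt hl.le]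
  linarith

theorem exists_zero (P : WellData W D d l L κ b B K) (hε : SmallParam d l L κ K ε)
    (hη : 0 < η) (hη1 : η ≤ 1) : ∃ c ∈ Ioo (-1) (-1 + d), energy W b K ε η c = 0 := by
  have hd := P.d_pos
  have hd1 := P.d_le
  have hb := P.b_pos
  have hl := P.l_pos
  have hK : 0 < K := one_pos.trans_le P.one_le_K
  have hε0 := hε.pos
  have h1 : energy W b K ε η (-1) < 0 := by
    have : 0 < ε * K * η ^ 2 := by positivity
    rw [energy, P.well.2.1, bump_of_nonpos hb η (by norm_num),
      cutoff_of_le hb (by linarith [P.b_le])]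
    norm_num
    linarith
  have h2 : 0 < energy W b K ε η (-1 + d) :=
    lt_of_lt_of_le (by positivity) (P.core_lower' hε hη.le hη1 ⟨le_rfl, by linarith⟩)
  exact intermediate_value_Ioo (by linarith) ((P.energy_continuousOn ε η).mono
    (Icc_subset_Icc_right (by linarith))) ⟨h1, h2⟩

theorem energy_eq_left (P : WellData W D d l L κ b B K) (ε η : ℝ) {u : ℝ}
    (hu : u ∈ Icc (-1) (-1 + d)) : energy W b K ε η u = W u - ε * K * (1 + u + η) ^ 2 := by
  have hd1 := P.d_le
  have hb1 := P.b_le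
  have hu0 : u ≤ 0 := by linarith [hu.2]
  rw [energy, bump_of_nonpos P.b_pos η hu0, cutoff_of_le P.b_pos (by linarith [hu.2]),
    abs_of_nonpos hu0]
  ring

theorem left_lower (P : WellData W D d l L κ b B K) (hε : SmallParam d l L κ K ε)
    (hη : 0 < η) (hc : c ∈ Ioo (-1) (-1 + d)) (h0 : energy W b K ε η c = 0)
    {u : ℝ} (hu : u ∈ Icc c (-1 + d)) :
    κ / 4 * ((u - c) * (u - c + 2 * (1 + c))) ≤ energy W b K ε η u := by
  have hd1 := P.d_le
  have hL := P.one_le_L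
  have hκ := P.κ_pos
  have hK : 0 < K := one_pos.trans_le P.one_le_K
  have hεK : 0 ≤ ε * K := mul_nonneg hε.pos.le hK.le
  have hxc : 0 < 1 + c := by linarith [hc.1]
  have hub := P.upper c ⟨hc.1.le, by linarith [hc.2]⟩
  have hcW : W c = ε * K * (1 + c + η) ^ 2 := by
    have := P.energy_eq_left ε η (u := c) (Ioo_subset_Icc_self hc)
    linarith
  rw [hcW, abs_of_neg (by linarith [hc.2])] at hub
  set r := √(ε * K) with hr
  have hrr : r ^ 2 = ε * K := Real.sq_sqrt hεK
  have hr0 : 0 ≤ r := Real.sqrt_nonneg _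
  have hrc : r * (1 + c + η) ≤ L * (1 + c) := by
    refine (pow_le_pow_iff_left₀ (by positivity) (by positivity) two_ne_zero).1 ?_
    rw [mul_pow, hrr]
    nlinarith [mul_nonneg (by nlinarith : 0 ≤ L ^ 2 - L) (sq_nonneg (1 + c))]
  have hrκ : 4 * (L * r) ≤ κ := by
    refine (pow_le_pow_iff_left₀ (by positivity) hκ.le two_ne_zero).1 ?_
    have := hε.le_slope
    rw [← hrr] at this
    nlinarith
  have hder : ∀ v ∈ Icc c (-1 + d), ε * K * (1 + v + η) ≤ κ / 4 * (1 + v) := by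
    intro v hv
    have hv0 : 0 < 1 + v := by linarith [hv.1]
    have e1 : (1 + v + η) * (1 + c) ≤ (1 + c + η) * (1 + v) := by nlinarith [hv.1]
    have e2 : r * (1 + v + η) ≤ L * (1 + v) := by
      have : r * (1 + v + η) * (1 + c) ≤ L * (1 + v) * (1 + c) := by
        calc r * (1 + v + η) * (1 + c) = r * ((1 + v + η) * (1 + c)) := by ring
          _ ≤ r * ((1 + c + η) * (1 + v)) := mul_le_mul_of_nonneg_left e1 hr0
          _ = r * (1 + c + η) * (1 + v) := by ring
          _ ≤ L * (1 + c) * (1 + v) := mul_le_mul_of_nonneg_right hrc hv0.le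
          _ = _ := by ring
      exact le_of_mul_le_mul_right this hxc
    calc ε * K * (1 + v + η) = r * (r * (1 + v + η)) := by rw [← hrr]; ring
      _ ≤ r * (L * (1 + v)) := mul_le_mul_of_nonneg_left e2 hr0
      _ ≤ κ / 4 * (1 + v) := by nlinarith
  have hq : ∀ v : ℝ, HasDerivAt (fun v : ℝ => κ / 4 * (1 + v) ^ 2) (κ / 2 * (1 + v)) v := by
    intro v
    have := (((hasDerivAt_id v).const_add 1).pow 2).const_mul (κ / 4)
    refine this.congr_deriv ?_
    simp only [id]; ring
  have hsub : Icc c (-1 + d) ⊆ Icc (-1) 1 := Icc_subset_Icc hc.1.le (by linarith)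
  have hmono : MonotoneOn (fun v => energy W b K ε η v - κ / 4 * (1 + v) ^ 2)
      (Icc c (-1 + d)) := by
    have hqc : ContinuousOn (fun v : ℝ => κ / 4 * (1 + v) ^ 2) (Icc c (-1 + d)) :=
      fun v _ => (hq v).continuousAt.continuousWithinAt
    apply monotoneOn_of_hasDerivWithinAt_nonneg (convex_Icc _ _)
      (((P.energy_continuousOn ε η).mono hsub).sub hqc)
      (fun v hv => ((P.energy_hasDerivAt ε η (u := v) ?_).sub (hq v)).hasDerivWithinAt)
    · intro v hv
      have hvI := interior_subset hv
      have hv0 : v ≤ 0 := by linarith [hvI.2]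
      rw [bumpDeriv_of_le P.b_pos η
        (by rw [abs_of_nonpos hv0]; linarith [hvI.2, P.b_le]), abs_of_nonpos hv0]
      have := P.slope v ⟨hc.1.le.trans hvI.1, hvI.2⟩
      have := hder v hvI
      linarith
    · rw [interior_Icc] at hv
      exact ⟨hc.1.trans hv.1, by linarith [hv.2]⟩
  have := hmono (left_mem_Icc.2 hc.2.le) hu hu.1
  simp only [h0] at this
  linarith

theorem zero_lower (P : WellData W D d l L κ b B K) (hε : SmallParam d l L κ K ε)
    (hη : 0 < η) (hc : c ∈ Ioo (-1) (-1 + d)) (h0 : energy W b K ε η c = 0) :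
    √ε * η / L ≤ 1 + c := by
  have hd1 := P.d_le
  have hL := P.one_le_L
  have hxc : 0 < 1 + c := by linarith [hc.1]
  have hub := P.upper c ⟨hc.1.le, by linarith [hc.2]⟩
  have hcW := P.energy_eq_left ε η (u := c) (Ioo_subset_Icc_self hc)
  rw [abs_of_neg (by linarith [hc.2])] at hub
  rw [div_le_iff₀ (by linarith)]
  refine (pow_le_pow_iff_left₀ (by positivity) (by positivity) two_ne_zero).1 ?_
  rw [mul_pow, Real.sq_sqrt hε.pos.le]
  have e1 : ε * η ^ 2 ≤ ε * K * (1 + c + η) ^ 2 := by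
    rw [mul_assoc]
    apply mul_le_mul_of_nonneg_left _ hε.pos.le
    nlinarith [P.one_le_K, sq_nonneg η, sq_nonneg (1 + c + η)]
  nlinarith [mul_nonneg (by nlinarith : 0 ≤ L ^ 2 - L) (sq_nonneg (1 + c))]

theorem isEnergy_and_times (P : WellData W D d l L κ b B K) : ∃ k : ℝ, 0 < k ∧ ∀ ε η c : ℝ,
    SmallParam d l L κ K ε → 0 < η → η ≤ 1 → c ∈ Ioo (-1) (-1 + d) →
    energy W b K ε η c = 0 → IsEnergy (energy W b K ε η) c ∧
      -travelTime (energy W b K ε η) c ≤ k⁻¹ * Real.log (9 / (√ε * η / L)) ∧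
      travelTime (energy W b K ε η) 1 ≤ k⁻¹ * Real.log (9 / (√ε * η / L)) := by
  have hd := P.d_pos
  have hd1 := P.d_le
  have hl := P.l_pos
  have hκ := P.κ_pos
  have hL := P.one_le_L
  have hb := P.b_pos
  have hb1 := P.b_le
  set k := min 1 (min (κ / 4) (l * d ^ 2 / 4)) with hk
  have hk0 : 0 < k := by positivity
  have hk1 : k ≤ 1 := min_le_left _ _
  have hkk : k ^ 2 ≤ k := by nlinarith
  have hkκ : k ^ 2 ≤ κ / 4 := hkk.trans ((min_le_right _ _).trans (min_le_left _ _))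
  have hkl : k ^ 2 ≤ l * d ^ 2 / 4 := hkk.trans ((min_le_right _ _).trans (min_le_right _ _))
  have hkl' : k ^ 2 ≤ l / 16 := by
    have hd2 : d ^ 2 ≤ 1 / 4 := by nlinarith
    linarith [mul_le_mul_of_nonneg_left hd2 hl.le]
  have hk2 : k ^ 2 ≤ 1 := by nlinarith
  refine ⟨k, hk0, fun ε η c hε hη hη1 hc h0 => ?_⟩
  have hε0 := hε.pos
  have hxc : 0 < 1 + c := by linarith [hc.1]
  set a := √ε * η / L with ha
  have ha0 : 0 < a := by positivity
  have hac : a ≤ 1 + c := P.zero_lower hε hη hc h0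
  have ha1 : a ≤ 1 := by linarith [hc.2]
  have haε : a ^ 2 ≤ ε * η ^ 2 := by
    have : a ≤ √ε * η := div_le_self (by positivity) hL
    calc a ^ 2 ≤ (√ε * η) ^ 2 := pow_le_pow_left₀ ha0.le this 2
      _ = ε * η ^ 2 := by rw [mul_pow, Real.sq_sqrt hε0.le]
  set F := energy W b K ε η with hF
  have hcont : ContinuousOn F (Icc (-1) 1) := P.energy_continuousOn ε η
  have hleft : ∀ u ∈ Icc c 0, k ^ 2 * ((u - c) * (u - c + a)) ≤ F u := by
    intro u hu
    have hy : 0 ≤ u - c := sub_nonneg.2 hu.1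
    rcases le_total u (-1 + d) with h | h
    · have h1 := P.left_lower hε hη hc h0 ⟨hu.1, h⟩
      refine le_trans ?_ h1
      apply mul_le_mul hkκ _ (by positivity) (by positivity)
      exact mul_le_mul_of_nonneg_left (by linarith) hy
    · refine le_trans ?_ (P.core_lower' hε hη.le hη1 ⟨h, hu.2⟩)
      have : (u - c) * (u - c + a) ≤ 2 := by nlinarith [hu.2, hc.1]
      nlinarith [sq_nonneg k]
  have hrightpos : ∀ u ∈ Icc (0:ℝ) 1, k ^ 2 * ((1 - u) * (1 - u + a)) ≤ F u ∧ 0 < F u := by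
    intro u hu
    have hy : 0 ≤ 1 - u := sub_nonneg.2 hu.2
    have hlow := P.lower u ⟨by linarith [hu.1], hu.2⟩
    rw [abs_of_nonneg hu.1] at hlow
    rcases le_total u b with h | h
    · have hFW := P.le_energy_of_nonneg hε0.le η hu.1
      have hy2 : 1 / 2 ≤ 1 - u := by linarith
      have e1 : (1 - u) * (1 - u + a) ≤ 3 * (1 - u) ^ 2 := by nlinarith
      have e2 : k ^ 2 * ((1 - u) * (1 - u + a)) ≤ l / 16 * (3 * (1 - u) ^ 2) :=
        mul_le_mul hkl' e1 (by positivity) (by positivity)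
      have e3 : 0 < l * (1 - u) ^ 2 := by positivity
      constructor <;> linarith
    · have hFeq : F u = W u + ε * K * (1 + η - u) ^ 2 := by
        rw [hF, energy, bump_of_nonneg hb η hu.1, cutoff_of_le hb h, abs_of_nonneg hu.1, one_mul]
      have e1 : ε * η ^ 2 ≤ ε * K * (1 + η - u) ^ 2 := by
        rw [mul_assoc]
        apply mul_le_mul_of_nonneg_left _ hε0.le
        nlinarith [P.one_le_K, sq_nonneg η, sq_nonneg (1 + η - u)]
      have e2 : k ^ 2 * ((1 - u) * (1 - u + a)) ≤ k ^ 2 * (2 * (1 - u) ^ 2 + a ^ 2) :=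
        mul_le_mul_of_nonneg_left (by nlinarith [sq_nonneg (1 - u - a)]) (sq_nonneg k)
      have e3 : k ^ 2 * (2 * (1 - u) ^ 2) ≤ l / 16 * (2 * (1 - u) ^ 2) :=
        mul_le_mul_of_nonneg_right hkl' (by positivity)
      have e4 : k ^ 2 * a ^ 2 ≤ 1 * a ^ 2 := mul_le_mul_of_nonneg_right hk2 (sq_nonneg a)
      have e5 : 0 < ε * η ^ 2 := by positivity
      have e6 : 0 ≤ l * (1 - u) ^ 2 := by positivity
      constructor <;> linarith
  have hT1 := travel_left (p := c) (q := 0) (by linarith [hc.2]) (by linarith [hc.1]) hk0 ha0 ha1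
    (hcont.mono (Icc_subset_Icc hc.1.le zero_le_one)) hleft
  have hT2 := travel_right (p := 0) (q := 1) zero_le_one (by norm_num) hk0 ha0 ha1
    (hcont.mono (Icc_subset_Icc (by norm_num) le_rfl)) (fun u hu => (hrightpos u hu).1)
  refine ⟨⟨by linarith [hc.2], hcont.mono (Icc_subset_Icc_left hc.1.le), ?_, h0,
    hT1.1.trans hT2.1⟩, ?_, hT2.2⟩
  · intro u hu
    rcases le_total u 0 with h | h
    · have hy : 0 < u - c := sub_pos.2 hu.1
      exact lt_of_lt_of_le (by positivity) (hleft u ⟨hu.1.le, h⟩)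
    · exact (hrightpos u ⟨h, hu.2⟩).2
  · rw [travelTime, intervalIntegral.integral_symm, neg_neg]
    exact hT1.2

end WellData

/-- Relative comparison of square roots. -/
theorem abs_sqrt_div_sqrt_sub_one_le {x y : ℝ} (hx : 0 ≤ x) (hy : 0 < y) :
    |(√y)⁻¹ * √x - 1| ≤ |x - y| / y := by
  have hs : 0 < √y := Real.sqrt_pos.2 hy
  have e : (√y)⁻¹ * √x - 1 = (√x - √y) / √y := by field_simp
  have hxy : x - y = (√x - √y) * (√x + √y) := by
    linear_combination -Real.sq_sqrt hx + Real.sq_sqrt hy.le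
  rw [e, abs_div, abs_of_pos hs, div_le_div_iff₀ hs hy, hxy, abs_mul,
    abs_of_nonneg (by positivity : 0 ≤ √x + √y), mul_assoc]
  apply mul_le_mul_of_nonneg_left _ (abs_nonneg _)
  nlinarith [Real.sq_sqrt hy.le, mul_nonneg (Real.sqrt_nonneg x) hs.le]

namespace WellData

variable {W g : ℝ → ℝ} {D d l L κ b B K : ℝ}

theorem abs_sub_profile_le (P : WellData W D d l L κ b B K) (hg : IsOneDSolution W g)
    (hd4 : d ≤ 1 + g (-4)) : ∃ M : ℝ, 0 < M ∧ ∀ ε η c G, SmallParam d l L κ K ε →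
      0 < η → η ≤ 1 → c ∈ Ioo (-1) (-1 + d) → IsEnergy (energy W b K ε η) c →
      IsProfile (energy W b K ε η) c G → ∀ t ∈ Icc (-4:ℝ) 4, |g t - G t| ≤ M * ε := by
  have hd := P.d_pos
  have hd1 := P.d_le
  have hl := P.l_pos
  have hL := P.one_le_L
  have hK : 0 < K := one_pos.trans_le P.one_le_K
  have hg4 : 0 < 1 - g 4 := sub_pos.2 (hg.2.1 4).2
  have hgm : StrictMono g := strictMono_of_deriv_pos hg.2.2.2.1
  set m := min (l * d ^ 2 / 2) (l * (1 - g 4) ^ 2) with hm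
  have hm0 : 0 < m := by positivity
  refine ⟨2 * (L + 1) * (8 * K / m * 4), by positivity,
    fun ε η c G hε hη hη1 hc hF hG t ht => ?_⟩
  have hε0 := hε.pos
  set F := energy W b K ε η with hFdef
  have hrange : ∀ s ∈ Icc (-4:ℝ) 4, g s ∈ Icc (-1 + d) (g 4) := fun s hs =>
    ⟨by linarith [hgm.monotone hs.1], hgm.monotone hs.2⟩
  have hFm : ∀ s ∈ Icc (-4:ℝ) 4, m ≤ F (g s) := by
    intro s hs
    have hr := hrange s hs
    rcases le_total (g s) 0 with h | h
    · exact (min_le_left _ _).trans (P.core_lower' hε hη.le hη1 ⟨hr.1, h⟩)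
    · refine (min_le_right _ _).trans (le_trans ?_ (P.le_energy_of_nonneg hε0.le η h))
      refine le_trans ?_ (P.lower _ (Ioo_subset_Icc_self (hg.2.1 s)))
      rw [abs_of_nonneg h]
      exact mul_le_mul_of_nonneg_left
        (pow_le_pow_left₀ hg4.le (by linarith [hr.2]) 2) hl.le
  have hder : ∀ s ∈ Icc (-4:ℝ) 4, HasDerivWithinAt (fun s => travelTime F (g s) - s)
      ((√(2 * F (g s)))⁻¹ * √(2 * W (g s)) - 1) (Icc (-4) 4) s := by
    intro s hs
    have hgs : HasDerivAt g (√(2 * W (g s))) s := by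
      rw [← hg.deriv_eq P.well s]
      exact (hg.1.differentiable (by norm_num) s).hasDerivAt
    have := (hF.hasDerivAt (u := g s) ⟨by linarith [hc.2, (hrange s hs).1], (hg.2.1 s).2⟩).comp s hgs
    exact (this.sub (hasDerivAt_id s)).hasDerivWithinAt
  have hbound : ∀ s ∈ Icc (-4:ℝ) 4,
      ‖(√(2 * F (g s)))⁻¹ * √(2 * W (g s)) - 1‖ ≤ 8 * K / m * ε := by
    intro s hs
    have hF0 := hm0.trans_le (hFm s hs)
    have hW0 := P.well.2.2.2.1 _ (hg.2.1 s)
    refine (abs_sqrt_div_sqrt_sub_one_le (by positivity) (by positivity)).trans ?_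
    have h1 := P.abs_energy_sub_le hε0.le η (g s)
    have h2 : (1 + η - |g s|) ^ 2 ≤ 4 := by
      have := (abs_lt.2 (hg.2.1 s)).le
      nlinarith [abs_nonneg (g s)]
    have h3 : |2 * W (g s) - 2 * F (g s)| ≤ 8 * K * ε := by
      rw [← mul_sub, abs_mul, abs_sub_comm, abs_of_pos (two_pos : (0:ℝ) < 2)]
      have := mul_le_mul_of_nonneg_left h2 (mul_nonneg hε0.le hK.le)
      linarith
    calc _ ≤ 8 * K * ε / m := div_le_div₀ (by positivity) h3 hm0 (by linarith [hFm s hs])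
      _ = _ := by ring
  have hmv := (convex_Icc (-4:ℝ) 4).norm_image_sub_le_of_norm_hasDerivWithin_le hder hbound
    (show (0:ℝ) ∈ Icc (-4:ℝ) 4 by constructor <;> norm_num) ht
  simp only [hg.2.2.2.2.1, IsEnergy.travelTime_zero, sub_zero, Real.norm_eq_abs] at hmv
  have hgt : g t ∈ Icc c 1 := ⟨by linarith [hc.2, (hrange t ht).1], (hg.2.1 t).2.le⟩
  have hlip := hG.lipschitz hF (M := 2 * (L + 1)) (fun u hu => by
    refine (P.sqrt_energy_le hε hη.le ⟨hc.1.le.trans hu.1, hu.2⟩).trans ?_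
    nlinarith [abs_nonneg u]) (travelTime F (g t)) t
  rw [hG.leftInv _ hgt] at hlip
  calc |g t - G t| ≤ 2 * (L + 1) * |travelTime F (g t) - t| := hlip
    _ ≤ 2 * (L + 1) * (8 * K / m * ε * 4) := by
        apply mul_le_mul_of_nonneg_left _ (by positivity)
        exact hmv.trans (mul_le_mul_of_nonneg_left (abs_le.2 ht) (by positivity))
    _ = _ := by ring

end WellData

theorem inv_sqrt_le_inv_sqrt_add {x y m r : ℝ} (hm : 0 < m) (hx : m ^ 2 ≤ x) (hy : m ^ 2 ≤ y)
    (hr : 0 ≤ r) (hxy : y - x ≤ r * m ^ 3) : (√x)⁻¹ ≤ (√y)⁻¹ + r := by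
  have hmx : m ≤ √x := Real.le_sqrt_of_sq_le hx
  have hmy : m ≤ √y := Real.le_sqrt_of_sq_le hy
  have hx0 : 0 < √x := hm.trans_le hmx
  have hy0 : 0 < √y := hm.trans_le hmy
  have hxx := Real.sq_sqrt ((sq_nonneg m).trans hx)
  have hyy := Real.sq_sqrt ((sq_nonneg m).trans hy)
  have h1 : (√y - √x) * m ≤ r * m ^ 3 := by
    rcases le_total (√y) (√x) with h | h
    · have : 0 ≤ (√x - √y) * m := mul_nonneg (sub_nonneg.2 h) hm.le
      have : 0 ≤ r * m ^ 3 := by positivity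
      linarith
    · calc (√y - √x) * m ≤ (√y - √x) * (√y + √x) :=
            mul_le_mul_of_nonneg_left (by linarith) (sub_nonneg.2 h)
        _ = y - x := by linear_combination hyy - hxx
        _ ≤ _ := hxy
  have h2 : √y - √x ≤ r * (√x * √y) := by
    have h3 : √y - √x ≤ r * (m * m) := le_of_mul_le_mul_right (by linarith) hm
    exact h3.trans (mul_le_mul_of_nonneg_left (mul_le_mul hmx hmy hm.le hx0.le) hr)
  have h4 : (√x)⁻¹ - (√y)⁻¹ = (√y - √x) / (√x * √y) := by field_simp
  have h5 : (√y - √x) / (√x * √y) ≤ r := (div_le_iff₀ (by positivity)).2 h2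
  linarith

/-- Profiles are ordered up to a time shift when their travel times are. -/
theorem IsProfile.le_shift {F₁ F₂ G₁ G₂ : ℝ → ℝ} {c₁ c₂ r : ℝ} (h₁ : IsEnergy F₁ c₁)
    (hG₁ : IsProfile F₁ c₁ G₁) (hG₂ : IsProfile F₂ c₂ G₂) (hc : c₁ ≤ c₂)
    (hT : ∀ u ∈ Icc c₂ 1, travelTime F₂ u ≤ travelTime F₁ u + r) (s : ℝ) :
    G₁ s ≤ G₂ (s + r) := by
  rcases le_total (G₁ s) c₂ with h | h
  · exact h.trans (hG₂.mem _).1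
  have hu : G₁ s ∈ Icc c₂ 1 := ⟨h, (hG₁.mem s).2⟩
  have hlt := (h₁.travelTime_neg.trans h₁.travelTime_pos).le
  rcases lt_or_ge s (travelTime F₁ c₁) with hs | hs
  · rw [hG₁.left s hs.le]
    exact hc.trans (hG₂.mem _).1
  have hts : travelTime F₁ (G₁ s) ≤ s := by
    rcases le_total s (travelTime F₁ 1) with h1 | h1
    · exact (hG₁.rightInv s ⟨hs, h1⟩).le
    · rwa [hG₁.right s h1]
  rw [← hG₂.leftInv _ hu]
  exact hG₂.mono ((hT _ hu).trans (by linarith))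

namespace WellData

variable {W : ℝ → ℝ} {D d l L κ b B K ε σ θ : ℝ}

theorem mul_sq_le_mul_sq_of_le {y : ℝ} (hσ : 0 < σ) (hε : 0 < ε) (hσθ : σ ≤ θ)
    (hθ : σ * (2 * θ) ^ 2 ≤ ε) (hy : 0 ≤ y) (hyθ : y ≤ θ) :
    σ * (y + σ) ^ 2 ≤ ε * (y + 1) ^ 2 := by
  calc σ * (y + σ) ^ 2 ≤ σ * (2 * θ) ^ 2 :=
        mul_le_mul_of_nonneg_left (pow_le_pow_left₀ (by linarith) (by linarith) 2) hσ.le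
    _ ≤ ε * 1 := by linarith
    _ ≤ _ := mul_le_mul_of_nonneg_left (by nlinarith) hε.le

theorem lt_of_energy_lt (P : WellData W D d l L κ b B K) (hσ : 0 < σ) (hε : 0 < ε) (hσθ : σ ≤ θ)
    (hθ : σ * (2 * θ) ^ 2 ≤ ε) {u : ℝ} (hu : u ∈ Icc (-1:ℝ) 1)
    (h : (0 ≤ u ∧ energy W b K ε 1 u < energy W b K σ σ u) ∨
      (u ≤ 0 ∧ energy W b K σ σ u < energy W b K ε 1 u)) : θ < 1 - |u| := by
  by_contra! hcon
  have hy : 0 ≤ 1 - |u| := sub_nonneg.2 (abs_le.2 hu)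
  have hK : 0 ≤ K := zero_le_one.trans P.one_le_K
  have hkey := mul_le_mul_of_nonneg_left
    (mul_sq_le_mul_sq_of_le hσ hε hσθ hθ hy hcon) hK
  rcases h with ⟨hu0, h⟩ | ⟨hu0, h⟩
  · have := mul_le_mul_of_nonneg_left hkey (cutoff_nonneg b u)
    simp only [energy, bump_of_nonneg P.b_pos _ hu0] at h
    linarith
  · have := mul_le_mul_of_nonneg_left hkey (cutoff_nonneg b (-u))
    simp only [energy, bump_of_nonpos P.b_pos _ hu0] at h
    linarith

theorem abs_energy_sub_le_of_lt (P : WellData W D d l L κ b B K) (hσ : 0 < σ) {u : ℝ}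
    (hu : σ < 1 - |u|) : |energy W b K σ σ u - W u| ≤ 4 * K * σ * (1 - |u|) ^ 2 := by
  have hK : 0 ≤ K := zero_le_one.trans P.one_le_K
  refine (P.abs_energy_sub_le hσ.le σ u).trans ?_
  calc σ * K * (1 + σ - |u|) ^ 2 ≤ σ * K * (2 * (1 - |u|)) ^ 2 :=
        mul_le_mul_of_nonneg_left (pow_le_pow_left₀ (by linarith) (by linarith) 2)
          (mul_nonneg hσ.le hK)
    _ = _ := by ring

theorem half_le_energy_of_lt (P : WellData W D d l L κ b B K) (hσ : 0 < σ)
    (hσl : 8 * K * σ ≤ l) {u : ℝ} (hu1 : u ∈ Icc (-1:ℝ) 1) (hu : σ < 1 - |u|) :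
    l * (1 - |u|) ^ 2 ≤ 2 * energy W b K σ σ u := by
  have h1 := (abs_le.1 (P.abs_energy_sub_le_of_lt hσ hu)).1
  have h2 := P.lower u hu1
  have h3 := mul_le_mul_of_nonneg_right hσl (sq_nonneg (1 - |u|))
  linarith

theorem speed_shift (P : WellData W D d l L κ b B K) (hσ : 0 < σ) (hθ0 : 0 < θ)
    (hσθ : σ ≤ θ) {u : ℝ} (hu : θ < 1 - |u|) {x y : ℝ}
    (hx : l * (1 - |u|) ^ 2 ≤ x) (hy : l * (1 - |u|) ^ 2 ≤ y)
    (hxy : y - x ≤ 2 * |energy W b K σ σ u - W u|) :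
    (√x)⁻¹ ≤ (√y)⁻¹ + 8 * K / √l ^ 3 * (σ / θ) := by
  have hK : 0 < K := one_pos.trans_le P.one_le_K
  have hl := P.l_pos
  have hs : 0 < √l := Real.sqrt_pos.2 hl
  have hy0 : 0 < 1 - |u| := hθ0.trans hu
  have hm : (√l * (1 - |u|)) ^ 2 = l * (1 - |u|) ^ 2 := by rw [mul_pow, Real.sq_sqrt hl.le]
  refine inv_sqrt_le_inv_sqrt_add (m := √l * (1 - |u|)) (by positivity) (by rwa [hm])
    (by rwa [hm]) (by positivity) ?_
  have h1 := P.abs_energy_sub_le_of_lt hσ (hσθ.trans_lt hu)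
  calc y - x ≤ 8 * K * σ * (1 - |u|) ^ 2 * 1 := by linarith
    _ ≤ 8 * K * σ * (1 - |u|) ^ 2 * ((1 - |u|) / θ) :=
        mul_le_mul_of_nonneg_left ((one_le_div hθ0).2 hu.le) (by positivity)
    _ = _ := by field_simp

theorem profile_le_shift (P : WellData W D d l L κ b B K) (hσ : 0 < σ) (hε : 0 < ε)
    (hσl : 8 * K * σ ≤ l) (hσθ : σ ≤ θ) (hθ : σ * (2 * θ) ^ 2 ≤ ε) {c₁ c₂ : ℝ} {G₁ G₂ : ℝ → ℝ}
    (hc₁ : -1 < c₁) (h₁ : IsEnergy (energy W b K σ σ) c₁)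
    (hG₁ : IsProfile (energy W b K σ σ) c₁ G₁)
    (hc₂ : -1 < c₂) (h₂ : IsEnergy (energy W b K ε 1) c₂)
    (hG₂ : IsProfile (energy W b K ε 1) c₂ G₂) {r : ℝ}
    (hr : 8 * K / √l ^ 3 * (σ / θ) ≤ r) (s : ℝ) : G₁ s ≤ G₂ (s + r) := by
  have hθ0 : 0 < θ := hσ.trans_le hσθ
  have hK : 0 < K := one_pos.trans_le P.one_le_K
  have hl := P.l_pos
  have hr0 : 0 ≤ r := le_trans (by positivity) hr
  have hc : c₁ ≤ c₂ := by
    by_contra! hcon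
    have hcI : c₁ ∈ Icc (-1:ℝ) 1 := ⟨hc₁.le, h₁.lt_one.le⟩
    have h0 := h₂.pos c₁ ⟨hcon, h₁.lt_one.le⟩
    have hlt := P.lt_of_energy_lt hσ hε hσθ hθ hcI (Or.inr ⟨h₁.neg.le, by rwa [h₁.zero]⟩)
    have hhalf := P.half_le_energy_of_lt hσ hσl hcI (hσθ.trans_lt hlt)
    rw [h₁.zero, mul_zero] at hhalf
    have : 0 < l * (1 - |c₁|) ^ 2 := mul_pos hl (pow_pos (hθ0.trans hlt) 2)
    linarith
  have hright : ∀ v ∈ Icc (0:ℝ) 1,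
      (√(2 * energy W b K ε 1 v))⁻¹ ≤ (√(2 * energy W b K σ σ v))⁻¹ + r := by
    intro v hv
    have hvI : v ∈ Icc (-1:ℝ) 1 := ⟨by linarith [hv.1], hv.2⟩
    have hp₁ := h₁.pos v ⟨h₁.neg.trans_le hv.1, hv.2⟩
    rcases le_or_gt (energy W b K σ σ v) (energy W b K ε 1 v) with h | h
    · have : (√(2 * energy W b K ε 1 v))⁻¹ ≤ (√(2 * energy W b K σ σ v))⁻¹ :=
        inv_anti₀ (by positivity) (Real.sqrt_le_sqrt (by linarith))
      linarith
    · have hlt := P.lt_of_energy_lt hσ hε hσθ hθ hvI (Or.inl ⟨hv.1, h⟩)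
      have hlow := P.lower v hvI
      have hsq : 0 ≤ l * (1 - |v|) ^ 2 := by positivity
      have e₁ := P.le_energy_of_nonneg hσ.le σ hv.1
      have e₂ := P.le_energy_of_nonneg hε.le 1 hv.1
      refine (P.speed_shift hσ hθ0 hσθ hlt (x := 2 * energy W b K ε 1 v)
        (y := 2 * energy W b K σ σ v) (by linarith) (by linarith) ?_).trans (by linarith)
      linarith [le_abs_self (energy W b K σ σ v - W v)]
  have hleft : ∀ v ∈ Ioc c₂ 0,
      (√(2 * energy W b K σ σ v))⁻¹ ≤ (√(2 * energy W b K ε 1 v))⁻¹ + r := by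
    intro v hv
    have hvI : v ∈ Icc (-1:ℝ) 1 := ⟨(hc₂.trans hv.1).le, by linarith [hv.2]⟩
    have hp₂ := h₂.pos v ⟨hv.1, by linarith [hv.2]⟩
    rcases le_or_gt (energy W b K ε 1 v) (energy W b K σ σ v) with h | h
    · have : (√(2 * energy W b K σ σ v))⁻¹ ≤ (√(2 * energy W b K ε 1 v))⁻¹ :=
        inv_anti₀ (by positivity) (Real.sqrt_le_sqrt (by linarith))
      linarith
    · have hlt := P.lt_of_energy_lt hσ hε hσθ hθ hvI (Or.inr ⟨hv.2, h⟩)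
      have hhalf := P.half_le_energy_of_lt hσ hσl hvI (hσθ.trans_lt hlt)
      have e₂ := P.energy_le_of_nonpos hε.le 1 hv.2
      refine (P.speed_shift hσ hθ0 hσθ hlt (x := 2 * energy W b K σ σ v)
        (y := 2 * energy W b K ε 1 v) hhalf (by linarith) ?_).trans (by linarith)
      linarith [neg_le_abs (energy W b K σ σ v - W v)]
  refine IsProfile.le_shift h₁ hG₁ hG₂ hc (fun u hu => ?_) s
  have hu₁ : u ∈ Icc c₁ 1 := ⟨hc.trans hu.1, hu.2⟩
  rcases le_total 0 u with h | h
  · have hm : ∫ v in (0:ℝ)..u, (√(2 * energy W b K ε 1 v))⁻¹ ≤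
        ∫ v in (0:ℝ)..u, ((√(2 * energy W b K σ σ v))⁻¹ + r) :=
      intervalIntegral.integral_mono_on_of_le_Ioo h (h₂.int_sub h₂.zero_mem hu)
        ((h₁.int_sub h₁.zero_mem hu₁).add intervalIntegrable_const)
        (fun v hv => hright v ⟨hv.1.le, hv.2.le.trans hu.2⟩)
    rw [intervalIntegral.integral_add (h₁.int_sub h₁.zero_mem hu₁) intervalIntegrable_const,
      intervalIntegral.integral_const, smul_eq_mul, sub_zero] at hm
    have := mul_le_mul_of_nonneg_right hu.2 hr0
    simp only [travelTime]
    linarith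
  · have hm : ∫ v in u..(0:ℝ), (√(2 * energy W b K σ σ v))⁻¹ ≤
        ∫ v in u..(0:ℝ), ((√(2 * energy W b K ε 1 v))⁻¹ + r) :=
      intervalIntegral.integral_mono_on_of_le_Ioo h (h₁.int_sub hu₁ h₁.zero_mem)
        ((h₂.int_sub hu h₂.zero_mem).add intervalIntegrable_const)
        (fun v hv => hleft v ⟨hu.1.trans_lt hv.1, hv.2.le⟩)
    rw [intervalIntegral.integral_add (h₂.int_sub hu h₂.zero_mem) intervalIntegrable_const,
      intervalIntegral.integral_const, smul_eq_mul] at hm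
    have := mul_le_mul_of_nonneg_right (show 0 - u ≤ 1 by linarith [hu.1]) hr0
    rw [travelTime, travelTime, intervalIntegral.integral_symm u 0,
      intervalIntegral.integral_symm u 0]
    linarith

end WellData

/-- `G` is the profile of the energy `F` started at `c`, has the regularity and the accuracy
required of a barrier of parameter `Q`, and satisfies the viscosity inequality. -/
structure IsBarrier (n : ℕ) (W g F : ℝ → ℝ) (M Q c : ℝ) (G : ℝ → ℝ) : Prop where
  gt : -1 < c
  energy : IsEnergy F c
  profile : IsProfile F c G
  smooth : ContDiffOn ℝ 2 G (Icc (travelTime F c) (travelTime F 1))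
  close : ∀ t ∈ Icc (-4:ℝ) 4, |g t - G t| ≤ M / Q
  visc : ∀ C, M ≤ C → OneDViscIneq n W C Q G

theorem IsBarrier.mem {n : ℕ} {W g F G : ℝ → ℝ} {M Q c : ℝ} (h : IsBarrier n W g F M Q c G)
    (t : ℝ) : G t ∈ Icc (-1:ℝ) 1 :=
  ⟨h.gt.le.trans (h.profile.mem t).1, (h.profile.mem t).2⟩

theorem WellData.exists_barrier {n : ℕ} {W g : ℝ → ℝ} {d l L κ b B K : ℝ}
    (P : WellData W (2 * ((n:ℝ) - 1)) d l L κ b B K) (hg : IsOneDSolution W g)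
    (hd4 : d ≤ 1 + g (-4)) : ∃ M k Q₀ : ℝ, 0 < M ∧ 0 < k ∧ 0 < Q₀ ∧ ∀ Q η : ℝ, Q₀ ≤ Q → 0 < η →
      η ≤ 1 → ∃ c G, IsBarrier n W g (energy W b K Q⁻¹ η) M Q c G ∧
        |travelTime (energy W b K Q⁻¹ η) c| ≤ k * Real.log (9 * L * √Q / η) ∧
        |travelTime (energy W b K Q⁻¹ η) 1| ≤ k * Real.log (9 * L * √Q / η) := by
  obtain ⟨M, hM, hclose⟩ := P.abs_sub_profile_le hg hd4
  obtain ⟨k, hk, htimes⟩ := P.isEnergy_and_times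
  obtain ⟨ε₀, hε₀, hsmall⟩ := P.exists_small
  have hd1 := P.d_le
  have hb := P.b_pos
  have hb1 := P.b_le
  have hL : 0 < L := one_pos.trans_le P.one_le_L
  refine ⟨max M (18 * B * K + 4 * K), k⁻¹, ε₀⁻¹, lt_max_of_lt_left hM, inv_pos.2 hk,
    inv_pos.2 hε₀, fun Q η hQ hη hη1 => ?_⟩
  have hQ0 : 0 < Q := (inv_pos.2 hε₀).trans_le hQ
  have hε := hsmall Q⁻¹ (inv_pos.2 hQ0) (inv_le_of_inv_le₀ hε₀ hQ)
  obtain ⟨c, hc, h0⟩ := P.exists_zero hε hη hη1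
  obtain ⟨hF, ht1, ht2⟩ := htimes Q⁻¹ η c hε hη hη1 hc h0
  obtain ⟨G, hG⟩ := hF.exists_profile
  have hlog : 9 / (√Q⁻¹ * η / L) = 9 * L * √Q / η := by
    have : 0 < √Q := Real.sqrt_pos.2 hQ0
    rw [Real.sqrt_inv]
    field_simp
  rw [hlog] at ht1 ht2
  have hf : ∀ u ∈ Ioo c 1, HasDerivAt (_root_.energy W b K Q⁻¹ η)
      (deriv W u + Q⁻¹ * K * bumpDeriv b η u) u := fun u hu =>
    P.energy_hasDerivAt Q⁻¹ η ⟨hc.1.trans hu.1, hu.2⟩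
  have hfc := (P.energyDeriv_continuousOn Q⁻¹ η).mono (Icc_subset_Icc_left hc.1.le)
  refine ⟨c, G, ⟨hc.1, hF, hG, hG.contDiffOn hF hf hfc, fun t ht => ?_, fun C hC => ?_⟩, ?_, ?_⟩
  · refine (hclose Q⁻¹ η c G hε hη hη1 hc hF hG t ht).trans ?_
    rw [div_eq_mul_inv]
    exact mul_le_mul_of_nonneg_right (le_max_left _ _) (inv_pos.2 hQ0).le
  · have hMC : M ≤ C := (le_max_left _ _).trans hC
    have hBC : 18 * B * K + 4 * K ≤ C := (le_max_right _ _).trans hC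
    refine hG.oneDViscIneq (b := b) hF hf (div_nonneg (hM.le.trans hMC) hQ0.le) hfc ?_
      P.well.2.2.2.2.2.1 ?_ ?_ ?_
    · exact le_trans (mul_nonneg P.κ_pos.le (by linarith [hc.1]))
        (P.slope c (Ioo_subset_Icc_self hc))
    · intro u hu hbu
      exact P.drift_outside hε hη.le ⟨(hc.1.trans hu.1).le, hu.2.le⟩ hbu
    · intro u hu _
      refine (P.drift_inside hε hη.le hη1 ⟨(hc.1.trans hu.1).le, hu.2.le⟩).trans ?_
      rw [div_eq_mul_inv C]
      have := mul_le_mul_of_nonneg_right hBC (inv_pos.2 hQ0).le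
      linarith
    · intro t ht
      exact hG.mem_Icc_of_core hF (s := √l / 2) (by have := P.l_pos; positivity)
        (by linarith [hc.2]) (by linarith) hb P.b_le_sqrt
        (fun u hu => P.speed_core hε hη.le hη1 hu) ht
  · rwa [abs_of_neg hF.travelTime_neg]
  · rwa [abs_of_pos hF.travelTime_pos]

theorem log_family_le {k L Q : ℝ} (hk : 0 ≤ k) (hL : 1 ≤ L) (hQ : 9 * L ≤ Q) :
    k * Real.log (9 * L * √Q / 1) ≤ 2 * k * Real.log Q := by
  have hQ1 : 1 ≤ Q := by linarith
  have hs : √Q ≤ Q := Real.sqrt_le_self_iff.2 (Or.inr hQ1)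
  have hs0 : 0 < √Q := by positivity
  have h : Real.log (9 * L * √Q / 1) ≤ Real.log (Q ^ 2) := by
    apply Real.log_le_log (by positivity)
    rw [div_one, sq]
    exact mul_le_mul hQ hs hs0.le (by linarith)
  rw [Real.log_pow] at h
  push_cast at h
  linarith [mul_le_mul_of_nonneg_left h hk]

theorem log_tight_le {k L R : ℝ} (hk : 0 ≤ k) (hL : 1 ≤ L) (hR : 9 * L ≤ R) :
    k * Real.log (9 * L * √R / R⁻¹) ≤ 3 * k * Real.log R := by
  have hR1 : 1 ≤ R := by linarith
  have hs : √R ≤ R := Real.sqrt_le_self_iff.2 (Or.inr hR1)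
  have hs0 : 0 < √R := by positivity
  have h : Real.log (9 * L * √R / R⁻¹) ≤ Real.log (R ^ 3) := by
    apply Real.log_le_log (by positivity)
    rw [div_inv_eq_mul, pow_succ, sq]
    exact mul_le_mul_of_nonneg_right (mul_le_mul hR hs hs0.le (by linarith)) (by linarith)
  rw [Real.log_pow] at h
  push_cast at h
  linarith [mul_le_mul_of_nonneg_left h hk]

theorem inv_le_mul_rpow {A R : ℝ} (hA : 1 ≤ A) (hR : 1 ≤ R) : R⁻¹ ≤ A * R ^ (-(4:ℝ) / 5) := by
  rw [← Real.rpow_neg_one]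
  have h1 : R ^ (-1:ℝ) ≤ R ^ (-(4:ℝ) / 5) := Real.rpow_le_rpow_of_exponent_le hR (by norm_num)
  have h2 : 0 < R ^ (-(4:ℝ) / 5) := Real.rpow_pos_of_pos (by linarith) _
  nlinarith

theorem inv_mul_sq_le_inv {A R Q : ℝ} (hR : 0 < R) (hQ : 0 < Q)
    (hRA : 128 * A ^ 2 ≤ R ^ ((1:ℝ) / 10)) (hQR : Q ≤ (4 * R) ^ ((5:ℝ) / 2)) :
    R⁻¹ * (2 * (A * R ^ (-(4:ℝ) / 5))) ^ 2 ≤ Q⁻¹ := by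
  have h4 : (4:ℝ) ^ ((5:ℝ) / 2) = 32 := by
    rw [show (4:ℝ) = 2 ^ (2:ℝ) by norm_num, ← Real.rpow_mul (by norm_num)]
    norm_num
  rw [Real.mul_rpow (by norm_num) hR.le, h4] at hQR
  have e2 : (R ^ (-(4:ℝ) / 5)) ^ 2 = R ^ (-(8:ℝ) / 5) := by
    rw [← Real.rpow_natCast, ← Real.rpow_mul hR.le]
    norm_num
  have e3 : R⁻¹ * R ^ (-(8:ℝ) / 5) * R ^ ((5:ℝ) / 2) * R ^ ((1:ℝ) / 10) = 1 := by
    rw [← Real.rpow_neg_one, ← Real.rpow_add hR, ← Real.rpow_add hR, ← Real.rpow_add hR]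
    norm_num
  have hx : 0 < R⁻¹ * R ^ (-(8:ℝ) / 5) := by positivity
  have hy : 0 < R ^ ((5:ℝ) / 2) := by positivity
  rw [← one_div Q, le_div_iff₀ hQ]
  calc R⁻¹ * (2 * (A * R ^ (-(4:ℝ) / 5))) ^ 2 * Q
      = 4 * A ^ 2 * (R⁻¹ * R ^ (-(8:ℝ) / 5)) * Q := by rw [← e2]; ring
    _ ≤ 4 * A ^ 2 * (R⁻¹ * R ^ (-(8:ℝ) / 5)) * (32 * R ^ ((5:ℝ) / 2)) :=
        mul_le_mul_of_nonneg_left hQR (by positivity)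
    _ = R⁻¹ * R ^ (-(8:ℝ) / 5) * R ^ ((5:ℝ) / 2) * (128 * A ^ 2) := by ring
    _ ≤ R⁻¹ * R ^ (-(8:ℝ) / 5) * R ^ ((5:ℝ) / 2) * R ^ ((1:ℝ) / 10) :=
        mul_le_mul_of_nonneg_left hRA (mul_pos hx hy).le
    _ = 1 := e3

theorem inv_div_mul_rpow_le {A B R : ℝ} (hA : 0 < A) (hBA : B ≤ A) (hR : 0 < R) :
    B * (R⁻¹ / (A * R ^ (-(4:ℝ) / 5))) ≤ R ^ (-(1:ℝ) / 5) := by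
  have e : R⁻¹ = R ^ (-(1:ℝ) / 5) * R ^ (-(4:ℝ) / 5) := by
    rw [← Real.rpow_neg_one, ← Real.rpow_add hR]
    norm_num
  have h4 : 0 < R ^ (-(4:ℝ) / 5) := Real.rpow_pos_of_pos hR _
  have h1 : 0 < R ^ (-(1:ℝ) / 5) := Real.rpow_pos_of_pos hR _
  rw [e, mul_div_mul_right _ _ h4.ne', ← mul_div_assoc, div_le_iff₀ hA]
  nlinarith

/-- Lemma 5.2: a tighter barrier `ρ_R`, strictly increasing and `C²` on
`[q_R⁻, q_R⁺] ⊂ [-R/2, R/2]`, constant outside with value `1` on the right, `ρ_R(0)=0`,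
`ρ_R'(q_R⁻)=0`, `|g-ρ_R| ≤ C/R` on `[-4,4]`, satisfying the viscosity inequality and
moreover `ρ_R(s) ≤ g_Q(s + R^{-1/5})` for all large `Q ≤ (4R)^{5/2}`. -/
theorem oneD_tight_radial_barrier
    (n : ℕ) (hn : 1 ≤ n) (W : ℝ → ℝ) (hW : DoubleWell W)
    (g : ℝ → ℝ) (hg : IsOneDSolution W g) :
    ∃ C : ℝ, 0 < C ∧ ∃ Q₀ : ℝ, 0 < Q₀ ∧ ∃ R₀ : ℝ, ∀ R : ℝ, R₀ ≤ R →
      ∃ gfam : ℝ → ℝ → ℝ,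
        (∀ Q : ℝ, Q₀ ≤ Q → Q ≤ (4*R) ^ ((5:ℝ)/2) → OneDBarrier n W g C Q (gfam Q)) ∧
        ∃ (ρ : ℝ → ℝ) (qm qp : ℝ),
          qm < 0 ∧ 0 < qp ∧ |qm| ≤ R / 2 ∧ |qp| ≤ R / 2 ∧
          (∀ t, ρ t ∈ Set.Icc (-1:ℝ) 1) ∧
          ContDiffOn ℝ 2 ρ (Set.Icc qm qp) ∧
          StrictMonoOn ρ (Set.Icc qm qp) ∧
          (∀ t ≤ qm, ρ t = ρ qm) ∧
          (∀ t, qp ≤ t → ρ t = 1) ∧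
          ρ 0 = 0 ∧ deriv ρ qm = 0 ∧
          (∀ t ∈ Set.Icc (-4:ℝ) 4, |g t - ρ t| ≤ C / R) ∧
          OneDViscIneq n W C R ρ ∧
          (∀ Q : ℝ, Q₀ ≤ Q → Q ≤ (4*R) ^ ((5:ℝ)/2) →
            ∀ s : ℝ, ρ s ≤ gfam Q (s + R ^ (-(1:ℝ)/5))) := by
  have hn1 : (1:ℝ) ≤ n := by exact_mod_cast hn
  obtain ⟨d, l, L, κ, b, B, K, hdr, P⟩ := hW.exists_wellData (D := 2 * ((n:ℝ) - 1))
    (r := 1 + g (-4)) (by linarith) (by linarith [(hg.2.1 (-4)).1])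
  obtain ⟨M, k, Q₁, hM, hk, hQ₁, hbar⟩ := P.exists_barrier hg hdr
  have hl := P.l_pos
  have hL := P.one_le_L
  choose! c G hG hG1 hG2 using fun Q (hQ : Q₁ ≤ Q) => hbar Q 1 hQ one_pos le_rfl
  set C := max M (2 * k) with hC
  have hMC : M ≤ C := le_max_left _ _
  have hkC : 2 * k ≤ C := le_max_right _ _
  set A := max 1 (8 * K / √l ^ 3) with hA
  have hA1 : 1 ≤ A := le_max_left _ _
  have hlogR : ∀ᶠ R : ℝ in atTop, 3 * k * Real.log R ≤ R / 2 := by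
    have := (Real.isLittleO_log_id_atTop.bound (c := (6 * k)⁻¹) (by positivity))
    filter_upwards [this, eventually_ge_atTop 1] with R hR hR1
    have h0 : 0 ≤ Real.log R := Real.log_nonneg hR1
    rw [Real.norm_of_nonneg h0, id, Real.norm_of_nonneg (by linarith), inv_mul_eq_div,
      le_div_iff₀ (by positivity)] at hR
    linarith
  have hpow : ∀ᶠ R : ℝ in atTop, 128 * A ^ 2 ≤ R ^ ((1:ℝ) / 10) :=
    (tendsto_rpow_atTop (by norm_num)).eventually_ge_atTop _
  obtain ⟨R₀, hR₀⟩ := eventually_atTop.1 (((hlogR.and hpow).and (eventually_ge_atTop Q₁)).and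
    ((eventually_ge_atTop (9 * L)).and (eventually_ge_atTop (8 * K / l))))
  refine ⟨C, lt_max_of_lt_left hM, max Q₁ (9 * L), lt_max_of_lt_left hQ₁, R₀, fun R hR => ?_⟩
  obtain ⟨⟨⟨hR1, hR2⟩, hR3⟩, hR4, hR5⟩ := hR₀ R hR
  have hRone : 1 ≤ R := by linarith
  have hR0 : 0 < R := by linarith
  obtain ⟨cρ, ρ, hρ, hρ1, hρ2⟩ := hbar R R⁻¹ hR3 (inv_pos.2 hR0) (inv_le_one_of_one_le₀ hRone)
  have hlog := (log_tight_le hk.le hL hR4).trans hR1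
  refine ⟨G, fun Q hQ _ => ?_, ρ, travelTime (energy W b K R⁻¹ R⁻¹) cρ,
    travelTime (energy W b K R⁻¹ R⁻¹) 1, hρ.energy.travelTime_neg, hρ.energy.travelTime_pos,
    hρ1.trans hlog, hρ2.trans hlog, hρ.mem, hρ.smooth, hρ.profile.strictMonoOn,
    fun t ht => by rw [hρ.profile.left t ht, hρ.profile.left _ le_rfl], hρ.profile.right,
    hρ.profile.zero hρ.energy, (hρ.profile.hasDerivAt_left hρ.energy).deriv,
    fun t ht => (hρ.close t ht).trans (div_le_div_of_nonneg_right hMC hR0.le),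
    hρ.visc C hMC, fun Q hQ hQR s => ?_⟩
  · have hQ' : Q₁ ≤ Q := (le_max_left _ _).trans hQ
    have hQL : 9 * L ≤ Q := (le_max_right _ _).trans hQ
    have hb := hG Q hQ'
    have ht : k * Real.log (9 * L * √Q / 1) ≤ C * Real.log Q :=
      (log_family_le hk.le hL hQL).trans
        (mul_le_mul_of_nonneg_right hkC (Real.log_nonneg (by linarith)))
    exact ⟨_, _, hb.energy.travelTime_neg, hb.energy.travelTime_pos, (hG1 Q hQ').trans ht,
      (hG2 Q hQ').trans ht, hb.mem, hb.smooth, hb.profile.strictMonoOn,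
      fun t ht => by rw [hb.profile.left t ht, hb.profile.left _ le_rfl], hb.profile.right,
      hb.profile.zero hb.energy, (hb.profile.hasDerivAt_left hb.energy).deriv,
      fun t ht => (hb.close t ht).trans (div_le_div_of_nonneg_right hMC (by linarith)),
      hb.visc C hMC⟩
  · have hQ' : Q₁ ≤ Q := (le_max_left _ _).trans hQ
    have hQ0 : 0 < Q := hQ₁.trans_le hQ'
    have hb := hG Q hQ'
    refine P.profile_le_shift (θ := A * R ^ (-(4:ℝ) / 5)) (inv_pos.2 hR0) (inv_pos.2 hQ0) ?_
      (inv_le_mul_rpow hA1 hRone) (inv_mul_sq_le_inv hR0 hQ0 hR2 hQR) hρ.gt hρ.energy hρ.profile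
      hb.gt hb.energy hb.profile
      (inv_div_mul_rpow_le (by linarith) (le_max_right _ _) hR0) s
    rw [← div_eq_mul_inv, div_le_iff₀ hR0]
    rw [div_le_iff₀ hl] at hR5
    linarith

end
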